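/- arXiv:2507.14974 — 2 statements merged into one kernel-verified Lean document; each statement's English description precedes it below -/
import Mathlib

section
/- Let n = 1 and 1 ≤ α ≤ 4/3. Then there is a constant C such that ‖ Σ_j λ_j |e^{it∂ₓ²}f_j|² ‖_{L^2(ℝ, L^∞(ℝ))} ≤ C ‖{λ_j}‖_{ℓ^α} for all families {f_j} of functions orthonormal in L²(ℝ) and all sequences {λ_j} ∈ ℓ^α. -/
noncomputable section

open MeasureTheory ENNReal Real Set

namespace OS

/-- `ℝⁿ` as a Euclidean space. -/
abbrev Rn (n : ℕ) := EuclideanSpace ℝ (Fin n)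

/-- The real dot product `x·ξ`, viewed as a complex number. -/
def dotC {n : ℕ} (x ξ : Rn n) : ℂ := ((∑ i, x i * ξ i : ℝ) : ℂ)

/-- The Fourier transform `f̂(ξ) = ∫ f(x) e^{-i x·ξ} dx`. -/
def FT {n : ℕ} (f : Rn n → ℂ) (ξ : Rn n) : ℂ :=
  ∫ x : Rn n, Complex.exp (-(Complex.I * dotC x ξ)) * f x

/-- The propagator `e^{itΔ}` composed with a Fourier multiplier `m`:
`x ↦ (2π)^{-n} ∫ e^{i(x·ξ - t|ξ|²)} m(ξ) f̂(ξ) dξ`. -/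
def prop {n : ℕ} (m : Rn n → ℂ) (f : Rn n → ℂ) (t : ℝ) (x : Rn n) : ℂ :=
  ((2 * π : ℝ) ^ (-(n : ℝ)) : ℝ) •
    ∫ ξ : Rn n, Complex.exp (Complex.I * (dotC x ξ - (t : ℂ) * ((‖ξ‖ : ℝ) : ℂ) ^ 2)) *
      (m ξ * FT f ξ)

/-- The free Schrödinger propagator `e^{itΔ} f`, as a function of `(t, x)`. -/
def schrodinger {n : ℕ} (f : Rn n → ℂ) : ℝ → Rn n → ℂ := prop (fun _ => 1) f

/-- The Fourier multiplier `|ξ|^{-s} ψ(2^{-k}|ξ|)` of `(-Δ)^{-s/2} P_k`. -/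
def LPmult {n : ℕ} (s : ℝ) (ψ : ℝ → ℝ) (k : ℤ) (ξ : Rn n) : ℂ :=
  ((‖ξ‖ ^ (-s) * ψ ((2 : ℝ) ^ (-k) * ‖ξ‖) : ℝ) : ℂ)

/-- The Littlewood–Paley projection `P_k h`. -/
def LP {n : ℕ} (ψ : ℝ → ℝ) (k : ℤ) (h : Rn n → ℂ) (x : Rn n) : ℂ :=
  ((2 * π : ℝ) ^ (-(n : ℝ)) : ℝ) •
    ∫ ξ : Rn n, Complex.exp (Complex.I * dotC x ξ) *
      (((ψ ((2 : ℝ) ^ (-k) * ‖ξ‖) : ℝ) : ℂ) * FT h ξ)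

/-- The standing hypotheses on the Littlewood–Paley bump function `ψ`:
smooth, `[0,1]`-valued, supported in `[1/2,2]`, with `∑_{k∈ℤ} ψ(2^{-k} r) = 1` for `r ≠ 0`. -/
structure IsLPF (ψ : ℝ → ℝ) : Prop where
  smooth : ContDiff ℝ (⊤ : ℕ∞) ψ
  mem_Icc : ∀ r, ψ r ∈ Icc (0 : ℝ) 1
  supp : Function.support ψ ⊆ Icc (1 / 2 : ℝ) 2
  sum_one : ∀ r : ℝ, r ≠ 0 → ∑' k : ℤ, ψ ((2 : ℝ) ^ (-k) * r) = 1

/-- Orthonormality in `L²(ℝⁿ)`. -/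
def OrthonormalL2 {n : ℕ} (f : ℕ → Rn n → ℂ) : Prop :=
  ∀ j k, (∫ x : Rn n, f j x * (starRingEnd ℂ) (f k x)) = if j = k then 1 else 0

/-- Orthonormality in the homogeneous Sobolev space `Ḣ^s(ℝⁿ)`:
`(2π)^{-n} ∫ |ξ|^{2s} f̂_j(ξ) conj(f̂_k(ξ)) dξ = δ_{jk}`. -/
def OrthonormalHs {n : ℕ} (s : ℝ) (f : ℕ → Rn n → ℂ) : Prop :=
  ∀ j k, ((2 * π : ℝ) ^ (-(n : ℝ)) : ℝ) •
    (∫ ξ : Rn n, ((‖ξ‖ ^ (2 * s) : ℝ) : ℂ) * (FT (f j) ξ * (starRingEnd ℂ) (FT (f k) ξ)))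
      = if j = k then 1 else 0

/-- The density `Σ_j λ_j |u_j(t,x)|²` of a system of space-time functions. -/
def density2 {n : ℕ} (lam : ℕ → ℝ) (u : ℕ → ℝ → Rn n → ℂ) (t : ℝ) (x : Rn n) : ℝ :=
  ∑' j, lam j * ‖u j t x‖ ^ 2

/-- The density `Σ_j λ_j |e^{itΔ}f_j(x)|²`. -/
def density {n : ℕ} (lam : ℕ → ℝ) (f : ℕ → Rn n → ℂ) : ℝ → Rn n → ℝ :=
  density2 lam fun j => schrodinger (f j)

/-- The `L^q` norm (w.r.t. `μ`) of an `ℝ≥0∞`-valued function. -/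
def eLp {α : Type*} [MeasurableSpace α] (μ : Measure α) (q : ℝ≥0∞) (F : α → ℝ≥0∞) : ℝ≥0∞ :=
  if q = ∞ then essSup F μ
  else (∫⁻ t, F t ^ q.toReal ∂μ) ^ (1 / q.toReal)

/-- The Lorentz `L^{p,r}` (quasi)norm of an `ℝ≥0∞`-valued function, via the
distribution function.  For `r = ∞` this is the weak-`L^p` quasinorm
`sup_{s>0} s μ(G > s)^{1/p} = sup_{t>0} t^{1/p} G^*(t)`. -/
def lor {α : Type*} [MeasurableSpace α] (μ : Measure α) (p r : ℝ≥0∞) (G : α → ℝ≥0∞) : ℝ≥0∞ :=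
  if p = ∞ then essSup G μ
  else if r = ∞ then
    ⨆ (s : ℝ) (_ : 0 < s), ENNReal.ofReal s * μ {x | ENNReal.ofReal s < G x} ^ (1 / p.toReal)
  else
    (∫⁻ s in Ioi (0 : ℝ),
      (ENNReal.ofReal s * μ {x | ENNReal.ofReal s < G x} ^ (1 / p.toReal)) ^ r.toReal *
        (ENNReal.ofReal s)⁻¹) ^ (1 / r.toReal)

/-- The mixed norm `‖u‖_{L^q(ℝ, L^p(ℝⁿ))}`. -/
def mixedLp {n : ℕ} {E : Type*} [NormedAddCommGroup E] (q p : ℝ≥0∞)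
    (u : ℝ → Rn n → E) : ℝ≥0∞ :=
  eLp volume q fun t => eLpNorm (u t) p volume

/-- The mixed norm `‖u‖_{L^{q,∞}(ℝ, L^p(ℝⁿ))}` (weak in time). -/
def mixedWeakLp {n : ℕ} {E : Type*} [NormedAddCommGroup E] (q p : ℝ≥0∞)
    (u : ℝ → Rn n → E) : ℝ≥0∞ :=
  lor volume q ∞ fun t => eLpNorm (u t) p volume

/-- The weak `L^{p,∞}(ℝⁿ)` quasinorm. -/
def wLp {n : ℕ} {E : Type*} [NormedAddCommGroup E] (p : ℝ≥0∞) (g : Rn n → E) : ℝ≥0∞ :=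
  lor volume p ∞ fun x => (‖g x‖₊ : ℝ≥0∞)

/-- The mixed Lorentz norm `‖u‖_{L^{q,r}(ℝ, L^{p,r̃}(ℝⁿ))}`. -/
def mixedLorentz {n : ℕ} {E : Type*} [NormedAddCommGroup E] (q r p rt : ℝ≥0∞)
    (u : ℝ → Rn n → E) : ℝ≥0∞ :=
  lor volume q r fun t => lor volume p rt fun x => (‖u t x‖₊ : ℝ≥0∞)

/-- The `ℓ^a` norm of a sequence (with `ℓ^∞` the supremum norm). -/
def seqNormE (a : ℝ≥0∞) (lam : ℕ → ℝ) : ℝ≥0∞ :=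
  if a = ∞ then ⨆ j, ENNReal.ofReal |lam j|
  else (∑' j, ENNReal.ofReal |lam j| ^ a.toReal) ^ (1 / a.toReal)

/-- The decreasing rearrangement of a sequence: `seqRearr lam j` is the
`(j+1)`-th largest value of `|lam i|`. -/
def seqRearr (lam : ℕ → ℝ) (j : ℕ) : ℝ≥0∞ :=
  sInf {s : ℝ≥0∞ | Measure.count {i : ℕ | s < ENNReal.ofReal |lam i|} ≤ (j : ℝ≥0∞)}

/-- The Lorentz sequence norm `‖lam‖_{ℓ^{q,r}} = (Σ_j (j^{1/q} λ*_j)^r / j)^{1/r}`,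
parametrized by `qinv = 1/q` and a finite second exponent `r`. -/
def seqLor (qinv r : ℝ) (lam : ℕ → ℝ) : ℝ≥0∞ :=
  (∑' j : ℕ, (((j : ℝ≥0∞) + 1) ^ qinv * seqRearr lam j) ^ r * ((j : ℝ≥0∞) + 1)⁻¹) ^ (1 / r)

/-- The interior of the triangle `OAB`, in the coordinates `(a, b) = (1/p, 1/q)`. -/
def IntOAB (n : ℕ) (a b : ℝ) : Prop :=
  a ∈ Ioo (0 : ℝ) 1 ∧ b ∈ Ioo (0 : ℝ) 1 ∧ b < (n : ℝ) / (n - 1) * a ∧ 2 * b + n * a < n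

/-- The interior of the quadrilateral `OCDA`, in the coordinates `(a, b) = (1/p, 1/q)`. -/
def IntOCDA (n : ℕ) (a b : ℝ) : Prop :=
  a ∈ Ioo (0 : ℝ) 1 ∧ b ∈ Ioo (0 : ℝ) 1 ∧ (n : ℝ) / (n - 1) * a < b ∧ 2 * b + n * a < n

def ptO : ℝ × ℝ := (0, 0)
def ptA (n : ℕ) : ℝ × ℝ := (((n : ℝ) - 1) / (n + 1), (n : ℝ) / (n + 1))
def ptB : ℝ × ℝ := (1, 0)
def ptC : ℝ × ℝ := (0, 1)
def ptD (n : ℕ) : ℝ × ℝ := (((n : ℝ) - 2) / n, 1)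

/-- The closed triangle `OAB`. -/
def OAB (n : ℕ) : Set (ℝ × ℝ) := convexHull ℝ {ptO, ptA n, ptB}

/-- The closed quadrilateral `OCDA`. -/
def OCDA (n : ℕ) : Set (ℝ × ℝ) := convexHull ℝ {ptO, ptC, ptD n, ptA n}

/-- The half-open segment `[A, D)`. -/
def segAD (n : ℕ) : Set (ℝ × ℝ) := {x | ∃ t ∈ Ico (0 : ℝ) 1, x = (1 - t) • ptA n + t • ptD n}

/-- The Lebesgue exponent with reciprocal `a` (so `expOf 0 = ∞`). -/
def expOf (a : ℝ) : ℝ≥0∞ := (ENNReal.ofReal a)⁻¹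

/-- The weighted velocity average `∫ f(x - tv, v) |v|^{-2s} dv` of the solution of
the kinetic transport equation with datum `f`. -/
def velAvg {n : ℕ} (s : ℝ) (f : Rn n × Rn n → ℂ) (t : ℝ) (x : Rn n) : ℂ :=
  ∫ v : Rn n, ((‖v‖ ^ (-(2 * s)) : ℝ) : ℂ) * f (x - t • v, v)

end OS

open OS

open scoped InnerProductSpace in
/-- An `ℓ⁴` Bessel-type inequality: the operator `e ↦ ∫ ⟪h t, e⟫ • h t` has its Schatten `4`-norm
bounded by a four-fold cyclic integral of Gram kernels. -/
theorem sum_integral_norm_inner_sq_pow_four_le {H : Type*} [NormedAddCommGroup H]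
    [InnerProductSpace ℂ H] [CompleteSpace H] {E : Type*} [NormedAddCommGroup E]
    [InnerProductSpace ℂ E] [CompleteSpace E] {ten : H → H → E}
    (htenc : Continuous fun z : H × H => ten z.1 z.2)
    (hten : ∀ x y x' y', ⟪ten x y, ten x' y'⟫_ℂ = ⟪x, x'⟫_ℂ * ⟪y', y⟫_ℂ)
    {T : Type*} [MeasurableSpace T] (μ : Measure T) [SFinite μ]
    {h : T → H} (hm : StronglyMeasurable h) (hi : Integrable (fun t => ‖h t‖ ^ 2) μ)
    {ι : Type*} {e : ι → H} (he : Orthonormal ℂ e) (s : Finset ι) :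
    ENNReal.ofReal (∑ j ∈ s, (∫ t, ‖⟪h t, e j⟫_ℂ‖ ^ 2 ∂μ) ^ 4) ≤
      ∫⁻ p : T × T, ∫⁻ q : T × T, ‖⟪h p.1, h p.2⟫_ℂ‖ₑ * ‖⟪h q.1, h q.2⟫_ℂ‖ₑ *
        (‖⟪h p.1, h q.1⟫_ℂ‖ₑ * ‖⟪h p.2, h q.2⟫_ℂ‖ₑ) ∂(μ.prod μ) ∂(μ.prod μ) := by
  have htenn : ∀ x y, ‖ten x y‖ = ‖x‖ * ‖y‖ := fun x y => by
    rw [← sq_eq_sq₀ (by positivity) (by positivity), mul_pow]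
    have := hten x y x y
    simp only [inner_self_eq_norm_sq_to_K] at this
    exact_mod_cast this
  let G : T × T → E := fun z => ⟪h z.1, h z.2⟫_ℂ • ten (h z.1) (h z.2)
  have hm1 : StronglyMeasurable fun z : T × T => h z.1 := hm.comp_measurable measurable_fst
  have hm2 : StronglyMeasurable fun z : T × T => h z.2 := hm.comp_measurable measurable_snd
  have hGm : StronglyMeasurable G :=
    (hm1.inner (𝕜 := ℂ) hm2).smul (htenc.comp_stronglyMeasurable (hm1.prodMk hm2))
  have hGi : Integrable G (μ.prod μ) := by
    refine (hi.mul_prod hi).mono hGm.aestronglyMeasurable (ae_of_all _ fun z => ?_)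
    rw [norm_smul, htenn, Real.norm_of_nonneg (by positivity)]
    calc _ ≤ ‖h z.1‖ * ‖h z.2‖ * (‖h z.1‖ * ‖h z.2‖) := by
          gcongr; exact norm_inner_le_norm _ _
      _ = _ := by ring
  have hA : ∀ e : H, Integrable (fun t => ⟪h t, e⟫_ℂ • h t) μ := fun e => by
    refine (hi.mul_const ‖e‖).mono
      ((hm.inner stronglyMeasurable_const).smul hm).aestronglyMeasurable (ae_of_all _ fun t => ?_)
    rw [norm_smul, Real.norm_of_nonneg (by positivity)]
    calc _ ≤ ‖h t‖ * ‖e‖ * ‖h t‖ := by gcongr; exact norm_inner_le_norm _ _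
      _ = _ := by ring
  have hD : ∀ e : H, ⟪e, ∫ t, ⟪h t, e⟫_ℂ • h t ∂μ⟫_ℂ = (∫ t, ‖⟪h t, e⟫_ℂ‖ ^ 2 ∂μ : ℝ) :=
    fun e => by
    rw [← integral_inner (hA e), ← integral_complex_ofReal]
    refine integral_congr_ae (ae_of_all _ fun t => ?_)
    simp only [inner_smul_right]
    rw [← inner_conj_symm e, RCLike.mul_conj]
    norm_cast
  have hQ : ∀ e : H, ⟪ten e e, ∫ z, G z ∂(μ.prod μ)⟫_ℂ =
      (‖∫ t, ⟪h t, e⟫_ℂ • h t ∂μ‖ : ℂ) ^ 2 := fun e => by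
    have hA' := hA e
    have hint : Integrable (fun z => ⟪ten e e, G z⟫_ℂ) (μ.prod μ) := hGi.const_inner _
    rw [← integral_inner hGi, integral_prod_symm _ hint]
    set A := ∫ t, ⟪h t, e⟫_ℂ • h t ∂μ with hAdef
    have := @inner_self_eq_norm_sq_to_K ℂ _ _ _ _ A
    refine Eq.trans ?_ this
    conv_rhs => rw [hAdef, ← hAdef, ← integral_inner hA']
    refine integral_congr_ae (ae_of_all _ fun t => ?_)
    simp only [G, inner_smul_right, hten]
    rw [← inner_conj_symm A, hAdef, ← integral_inner hA', ← integral_conj, ← integral_const_mul]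
    refine integral_congr_ae (ae_of_all _ fun u => ?_)
    simp only [inner_smul_right, map_mul, inner_conj_symm]
    ring
  set X := ∫ z, G z ∂(μ.prod μ) with hX
  have hDQ : ∀ j, (∫ t, ‖⟪h t, e j⟫_ℂ‖ ^ 2 ∂μ) ^ 4 ≤ ‖⟪ten (e j) (e j), X⟫_ℂ‖ ^ 2 := fun j => by
    rw [hQ]
    have h1 := norm_inner_le_norm (𝕜 := ℂ) (e j) (∫ t, ⟪h t, e j⟫_ℂ • h t ∂μ)
    rw [hD, he.1 j, one_mul, Complex.norm_real, Real.norm_of_nonneg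
      (integral_nonneg fun t => by positivity)] at h1
    rw [norm_pow, Complex.norm_real, norm_norm, ← pow_mul]
    exact pow_le_pow_left₀ (integral_nonneg fun t => by positivity) h1 4
  have hon : Orthonormal ℂ fun j => ten (e j) (e j) := by
    classical
    rw [orthonormal_iff_ite] at he ⊢
    intro i j
    rw [hten, he, he]
    by_cases hij : i = j
    · simp [hij]
    · simp [hij]
  have hXX : ENNReal.ofReal (‖X‖ ^ 2) ≤
      ∫⁻ p, ∫⁻ q, ‖⟪G p, G q⟫_ℂ‖ₑ ∂(μ.prod μ) ∂(μ.prod μ) := by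
    have h1 : ‖⟪X, X⟫_ℂ‖ₑ = ENNReal.ofReal (‖X‖ ^ 2) := by
      rw [← ofReal_norm, inner_self_eq_norm_sq_to_K]
      simp
    rw [← h1]
    nth_rw 2 [hX]
    rw [← integral_inner hGi]
    refine (enorm_integral_le_lintegral_enorm _).trans (lintegral_mono fun p => ?_)
    rw [← inner_conj_symm, RCLike.enorm_conj, ← integral_inner hGi]
    exact enorm_integral_le_lintegral_enorm _
  calc _ ≤ ENNReal.ofReal (‖X‖ ^ 2) := by
        refine ENNReal.ofReal_le_ofReal ((Finset.sum_le_sum fun j _ => hDQ j).trans ?_)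
        exact hon.sum_inner_products_le X
    _ ≤ _ := hXX
    _ = _ := by
        refine lintegral_congr fun p => lintegral_congr fun q => ?_
        simp only [G, inner_smul_left, inner_smul_right, hten, enorm_mul]
        rw [← inner_conj_symm (h q.2), RCLike.enorm_conj, RCLike.enorm_conj]
        ring

open scoped InnerProductSpace TensorProduct in
theorem L2.inner_star_star {X : Type*} [MeasurableSpace X] {ν : Measure X} (x y : Lp ℂ 2 ν) :
    ⟪star x, star y⟫_ℂ = ⟪y, x⟫_ℂ := by
  rw [L2.inner_def, L2.inner_def]
  refine integral_congr_ae ?_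
  filter_upwards [Lp.coeFn_star x, Lp.coeFn_star y] with a hx hy
  simp [hx, hy, mul_comm]

open scoped InnerProductSpace in
theorem L2.continuous_star {X : Type*} [MeasurableSpace X] {ν : Measure X} :
    Continuous fun x : Lp ℂ 2 ν => star x := by
  refine (Isometry.of_dist_eq fun x y => ?_).continuous
  rw [dist_eq_norm, dist_eq_norm, ← sq_eq_sq₀ (norm_nonneg _) (norm_nonneg _),
    @norm_sub_sq ℂ, @norm_sub_sq ℂ, @norm_sq_eq_re_inner ℂ _ _ _ _ (star x),
    @norm_sq_eq_re_inner ℂ _ _ _ _ (star y), L2.inner_star_star, L2.inner_star_star,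
    L2.inner_star_star, ← @norm_sq_eq_re_inner ℂ, ← @norm_sq_eq_re_inner ℂ, inner_re_symm]

open scoped InnerProductSpace TensorProduct in
theorem L2.sum_integral_norm_inner_sq_pow_four_le {X : Type*} [MeasurableSpace X] {ν : Measure X}
    {T : Type*} [MeasurableSpace T] (μ : Measure T)
    [SFinite μ] {h : T → Lp ℂ 2 ν} (hm : StronglyMeasurable h)
    (hi : Integrable (fun t => ‖h t‖ ^ 2) μ)
    {ι : Type*} {e : ι → Lp ℂ 2 ν} (he : Orthonormal ℂ e) (s : Finset ι) :
    ENNReal.ofReal (∑ j ∈ s, (∫ t, ‖⟪h t, e j⟫_ℂ‖ ^ 2 ∂μ) ^ 4) ≤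
      ∫⁻ p : T × T, ∫⁻ q : T × T, ‖⟪h p.1, h p.2⟫_ℂ‖ₑ * ‖⟪h q.1, h q.2⟫_ℂ‖ₑ *
        (‖⟪h p.1, h q.1⟫_ℂ‖ₑ * ‖⟪h p.2, h q.2⟫_ℂ‖ₑ) ∂(μ.prod μ) ∂(μ.prod μ) := by
  refine _root_.sum_integral_norm_inner_sq_pow_four_le
    (E := UniformSpace.Completion (Lp ℂ 2 ν ⊗[ℂ] Lp ℂ 2 ν))
    (ten := fun x y => ((x ⊗ₜ[ℂ] star y : Lp ℂ 2 ν ⊗[ℂ] Lp ℂ 2 ν) :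
      UniformSpace.Completion (Lp ℂ 2 ν ⊗[ℂ] Lp ℂ 2 ν))) ?_ ?_ μ hm hi he s
  · exact (UniformSpace.Completion.continuous_coe _).comp (TensorProduct.continuous_tmul.comp
      (continuous_fst.prodMk (L2.continuous_star.comp continuous_snd)))
  · intro x y x' y'
    rw [UniformSpace.Completion.inner_coe, TensorProduct.inner_tmul, L2.inner_star_star]

theorem lintegral_inv_rpow_Icc_lt_top {p : ℝ} (hp : 0 < p) (hp1 : p < 1) :
    ∫⁻ x in Icc (-1 : ℝ) 1, (‖x‖ₑ⁻¹) ^ p < ∞ := by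
  have h0 : IntervalIntegrable (fun x : ℝ => |x| ^ (-p)) volume 0 1 := by
    refine (intervalIntegral.intervalIntegrable_rpow' (by linarith : -1 < -p)).congr ?_
    intro x hx
    rw [uIoc_of_le zero_le_one] at hx
    simp [abs_of_pos hx.1]
  have h1 : IntervalIntegrable (fun x : ℝ => |x| ^ (-p)) volume (-1) 0 := by
    rw [IntervalIntegrable.iff_comp_neg]
    simpa using h0.symm
  have h2 := (h1.trans h0).1.hasFiniteIntegral
  rw [restrict_Ioc_eq_restrict_Icc] at h2
  refine lt_of_eq_of_lt (lintegral_congr_ae ?_) h2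
  filter_upwards [ae_restrict_of_ae (Measure.ae_ne volume (0 : ℝ))] with x hx
  have h3 : 0 < |x| := abs_pos.2 hx
  rw [Real.enorm_eq_ofReal_abs, Real.enorm_eq_ofReal_abs,
    abs_of_nonneg (by positivity : 0 ≤ |x| ^ (-p)),
    ← ENNReal.ofReal_inv_of_pos h3, ENNReal.ofReal_rpow_of_nonneg (by positivity) hp.le,
    Real.inv_rpow h3.le, Real.rpow_neg h3.le]

theorem inv_rpow_le_of_le {a : ℝ} {c : ℝ} (hc : 0 < c) {x : ℝ} (h : c ≤ |x|) (ha : 0 ≤ a) :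
    (‖x‖ₑ⁻¹) ^ a ≤ ENNReal.ofReal (c ^ (-a)) := by
  rw [Real.enorm_eq_ofReal_abs, ← ENNReal.ofReal_inv_of_pos (hc.trans_le h),
    ENNReal.ofReal_rpow_of_nonneg (by positivity) ha]
  apply ENNReal.ofReal_le_ofReal
  rw [Real.rpow_neg hc.le, ← Real.inv_rpow hc.le]
  gcongr

theorem lintegral_inv_rpow_mul_lt_top {p q : ℝ} (hp : 0 < p) (hp1 : p < 1) (hq : 0 < q)
    (hq1 : q < 1) (hpq : 1 < p + q) :
    ∫⁻ x : ℝ, (‖x‖ₑ⁻¹) ^ p * (‖x - 1‖ₑ⁻¹) ^ q < ∞ := by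
  have hbound : ∀ x : ℝ, (‖x‖ₑ⁻¹) ^ p * (‖x - 1‖ₑ⁻¹) ^ q ≤
      (ENNReal.ofReal ((1 / 2) ^ (-q)) * (Icc (-1 : ℝ) 1).indicator (fun x => (‖x‖ₑ⁻¹) ^ p) x +
      ENNReal.ofReal ((1 / 2) ^ (-p)) *
        (Icc (-1 : ℝ) 1).indicator (fun x => (‖x‖ₑ⁻¹) ^ q) (x - 1)) +
      ENNReal.ofReal ((1 / 3) ^ (-p) * (1 / 5) ^ (-q)) *
        ENNReal.ofReal ((1 + ‖x‖) ^ (-(p + q))) := by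
    intro x
    by_cases h1 : |x| ≤ 1 / 2
    · refine le_trans ?_ (le_trans le_self_add le_self_add)
      have hx := abs_le.1 h1
      rw [indicator_of_mem (by constructor <;> linarith), mul_comm]
      gcongr
      apply inv_rpow_le_of_le (by norm_num) _ hq.le
      rw [le_abs]; right; linarith
    by_cases h2 : |x - 1| ≤ 1 / 2
    · refine le_trans ?_ (le_trans le_add_self le_self_add)
      have hx := abs_le.1 h2
      rw [indicator_of_mem (by constructor <;> linarith)]
      gcongr
      exact inv_rpow_le_of_le (by norm_num) (not_le.1 h1).le hp.le
    · refine le_trans ?_ le_add_self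
      have h3 : 1 + |x| ≤ 3 * |x| := by linarith
      have h4 : 1 + |x| ≤ 5 * |x - 1| := by
        have := abs_add_le (x - 1) 1
        simp at this
        linarith
      have h5 : 0 < 1 + |x| := by positivity
      calc (‖x‖ₑ⁻¹) ^ p * (‖x - 1‖ₑ⁻¹) ^ q
          ≤ ENNReal.ofReal ((1 / 3 * (1 + |x|)) ^ (-p)) *
            ENNReal.ofReal ((1 / 5 * (1 + |x|)) ^ (-q)) := by
            gcongr
            · exact inv_rpow_le_of_le (by positivity) (by linarith) hp.le
            · exact inv_rpow_le_of_le (by positivity) (by linarith) hq.le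
        _ = _ := by
            rw [← ENNReal.ofReal_mul (by positivity), ← ENNReal.ofReal_mul (by positivity),
              Real.mul_rpow (by norm_num) h5.le, Real.mul_rpow (by norm_num) h5.le,
              Real.norm_eq_abs, neg_add, Real.rpow_add h5]
            congr 1; ring
  have hm : ∀ r : ℝ, Measurable fun x : ℝ => (‖x‖ₑ⁻¹) ^ r := fun r => by fun_prop
  refine (lintegral_mono hbound).trans_lt ?_
  rw [lintegral_add_right _ (by fun_prop), lintegral_add_left
    (((hm p).indicator measurableSet_Icc).const_mul _),
    lintegral_const_mul _ ((hm p).indicator measurableSet_Icc),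
    lintegral_const_mul' _ _ ofReal_ne_top, lintegral_const_mul' _ _ ofReal_ne_top,
    lintegral_sub_right_eq_self (fun x => (Icc (-1 : ℝ) 1).indicator (fun x => (‖x‖ₑ⁻¹) ^ q) x) 1,
    lintegral_indicator measurableSet_Icc, lintegral_indicator measurableSet_Icc]
  have h6 := finite_integral_one_add_norm (E := ℝ) (μ := volume) (r := p + q) (by simpa using hpq)
  exact ENNReal.add_lt_top.2 ⟨ENNReal.add_lt_top.2
    ⟨ENNReal.mul_lt_top ofReal_lt_top (lintegral_inv_rpow_Icc_lt_top hp hp1),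
      ENNReal.mul_lt_top ofReal_lt_top (lintegral_inv_rpow_Icc_lt_top hq hq1)⟩,
    ENNReal.mul_lt_top ofReal_lt_top h6⟩

theorem lintegral_comp_mul_left_real (f : ℝ → ℝ≥0∞) (hf : Measurable f) {d : ℝ} (hd : d ≠ 0) :
    ∫⁻ x, f x = ‖d‖ₑ * ∫⁻ x, f (d * x) := by
  have h := Real.smul_map_volume_mul_left hd
  conv_lhs => rw [← h]
  rw [lintegral_smul_measure, lintegral_map hf (by fun_prop), Real.enorm_eq_ofReal_abs, smul_eq_mul]

theorem lintegral_inv_rpow_mul_eq {p q : ℝ} (hp : 0 < p) (hq : 0 < q)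
    {d : ℝ} (hd : d ≠ 0) :
    ∫⁻ x : ℝ, (‖x‖ₑ⁻¹) ^ p * (‖x - d‖ₑ⁻¹) ^ q =
      (‖d‖ₑ⁻¹) ^ (p + q - 1) * ∫⁻ x : ℝ, (‖x‖ₑ⁻¹) ^ p * (‖x - 1‖ₑ⁻¹) ^ q := by
  rw [lintegral_comp_mul_left_real _ (by fun_prop) hd]
  have hd0 : ‖d‖ₑ ≠ 0 := by simpa using hd
  have hd1 : ‖d‖ₑ⁻¹ ≠ 0 := by simp
  have hd2 : ‖d‖ₑ⁻¹ ≠ ∞ := by simpa using hd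
  have h : ∀ x : ℝ, (‖d * x‖ₑ⁻¹) ^ p * (‖d * x - d‖ₑ⁻¹) ^ q =
      (‖d‖ₑ⁻¹) ^ (p + q) * ((‖x‖ₑ⁻¹) ^ p * (‖x - 1‖ₑ⁻¹) ^ q) := by
    intro x
    rw [show d * x - d = d * (x - 1) by ring, enorm_mul, enorm_mul,
      ENNReal.mul_inv (.inl hd0) (.inl enorm_ne_top),
      ENNReal.mul_inv (.inl hd0) (.inl enorm_ne_top),
      ENNReal.mul_rpow_of_nonneg _ _ hp.le, ENNReal.mul_rpow_of_nonneg _ _ hq.le,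
      ENNReal.rpow_add _ _ hd1 hd2]
    ring
  simp_rw [h]
  rw [lintegral_const_mul _ (by fun_prop), ← mul_assoc]
  congr 1
  rw [ENNReal.rpow_sub _ _ hd1 hd2, ENNReal.rpow_one, div_eq_mul_inv, inv_inv, mul_comm]

theorem lintegral_inv_rpow_sub_mul_eq {p q : ℝ} (hp : 0 < p) (hq : 0 < q)
    {a b : ℝ} (hab : a ≠ b) :
    ∫⁻ x : ℝ, (‖x - a‖ₑ⁻¹) ^ p * (‖b - x‖ₑ⁻¹) ^ q =
      (‖b - a‖ₑ⁻¹) ^ (p + q - 1) * ∫⁻ x : ℝ, (‖x‖ₑ⁻¹) ^ p * (‖x - 1‖ₑ⁻¹) ^ q := by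
  rw [← lintegral_inv_rpow_mul_eq hp hq (sub_ne_zero.2 hab.symm),
    ← lintegral_sub_right_eq_self (fun x : ℝ => (‖x‖ₑ⁻¹) ^ p * (‖x - (b - a)‖ₑ⁻¹) ^ q) a]
  refine lintegral_congr fun x => ?_
  rw [← enorm_neg (b - x)]
  congr 5; ring

theorem ENNReal.mul_le_sq_add_sq (x y : ℝ≥0∞) : x * y ≤ x ^ 2 + y ^ 2 := by
  rcases le_total x y with h | h
  · calc x * y ≤ y * y := by gcongr
      _ ≤ _ := by rw [sq y]; exact le_add_self
  · calc x * y ≤ x * x := by gcongr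
      _ ≤ _ := by rw [sq x]; exact le_self_add

theorem mul_rpow_quarter_le (v w : ℝ≥0∞) {A B : ℝ≥0∞} (hA : A ≠ 0) (hA' : A ≠ ∞)
    (hB : B ≠ 0) (hB' : B ≠ ∞) :
    v * w * (A ^ (1 / 4 : ℝ) * B ^ (1 / 4 : ℝ)) ≤
      v ^ 2 * A ^ (-1 / 4 : ℝ) * B ^ (3 / 4 : ℝ) + w ^ 2 * B ^ (-1 / 4 : ℝ) * A ^ (3 / 4 : ℝ) := by
  have h2 : ∀ (X : ℝ≥0∞) (r s : ℝ), r * 2 = s → (X ^ r) ^ 2 = X ^ s := fun X r s hrs => by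
    rw [← ENNReal.rpow_natCast, ← ENNReal.rpow_mul]; congr 1
  have h := ENNReal.mul_le_sq_add_sq (v * A ^ (-1 / 8 : ℝ) * B ^ (3 / 8 : ℝ))
    (w * B ^ (-1 / 8 : ℝ) * A ^ (3 / 8 : ℝ))
  simp only [mul_pow] at h
  rw [h2 A (-1 / 8) (-1 / 4) (by norm_num), h2 B (-1 / 8) (-1 / 4) (by norm_num),
    h2 A (3 / 8) (3 / 4) (by norm_num), h2 B (3 / 8) (3 / 4) (by norm_num)] at h
  refine le_trans (le_of_eq ?_) h
  rw [show (1 / 4 : ℝ) = -1 / 8 + 3 / 8 by norm_num, ENNReal.rpow_add _ _ hA hA',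
    ENNReal.rpow_add _ _ hB hB']
  ring

theorem steinWeiss_quarter_le {v : ℝ → ℝ≥0∞} (hv : Measurable v) (c : ℝ) :
    ∫⁻ a, ∫⁻ b, v a * v b * ((‖a - c‖ₑ⁻¹) ^ (1 / 4 : ℝ) * (‖b - c‖ₑ⁻¹) ^ (1 / 4 : ℝ)) *
      (‖a - b‖ₑ⁻¹) ^ (1 / 2 : ℝ) ≤
    2 * (∫⁻ x : ℝ, (‖x‖ₑ⁻¹) ^ (3 / 4 : ℝ) * (‖x - 1‖ₑ⁻¹) ^ (1 / 2 : ℝ)) * ∫⁻ a, v a ^ 2 := by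
  set C := ∫⁻ x : ℝ, (‖x‖ₑ⁻¹) ^ (3 / 4 : ℝ) * (‖x - 1‖ₑ⁻¹) ^ (1 / 2 : ℝ)
  have key : ∀ᵐ a : ℝ, ∫⁻ b : ℝ, v a ^ 2 * (‖a - c‖ₑ⁻¹) ^ (-1 / 4 : ℝ) *
      ((‖b - c‖ₑ⁻¹) ^ (3 / 4 : ℝ) * (‖a - b‖ₑ⁻¹) ^ (1 / 2 : ℝ)) = C * v a ^ 2 := by
    filter_upwards [Measure.ae_ne volume c] with a ha
    have h1 : ‖a - c‖ₑ⁻¹ ≠ ∞ := by simpa [sub_eq_zero] using ha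
    rw [lintegral_const_mul _ (by fun_prop),
      lintegral_inv_rpow_sub_mul_eq (by norm_num) (by norm_num) ha.symm,
      show (3 / 4 + 1 / 2 - 1 : ℝ) = 1 / 4 by norm_num, mul_assoc, ← mul_assoc (_ ^ (-1 / 4 : ℝ)),
      ← ENNReal.rpow_add _ _ (by simp) h1]
    rw [show (-1 / 4 + 1 / 4 : ℝ) = 0 by norm_num, ENNReal.rpow_zero, one_mul, mul_comm]
  calc _ ≤ ∫⁻ a, ∫⁻ b, (v a ^ 2 * (‖a - c‖ₑ⁻¹) ^ (-1 / 4 : ℝ) *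
          ((‖b - c‖ₑ⁻¹) ^ (3 / 4 : ℝ) * (‖a - b‖ₑ⁻¹) ^ (1 / 2 : ℝ)) +
        v b ^ 2 * (‖b - c‖ₑ⁻¹) ^ (-1 / 4 : ℝ) *
          ((‖a - c‖ₑ⁻¹) ^ (3 / 4 : ℝ) * (‖b - a‖ₑ⁻¹) ^ (1 / 2 : ℝ))) := by
        refine lintegral_mono_ae ?_
        filter_upwards [Measure.ae_ne volume c] with a ha
        refine lintegral_mono_ae ?_
        filter_upwards [Measure.ae_ne volume c] with b hb
        have h := mul_rpow_quarter_le (v a) (v b) (A := ‖a - c‖ₑ⁻¹) (B := ‖b - c‖ₑ⁻¹) (by simp)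
          (by simpa [sub_eq_zero] using ha) (by simp) (by simpa [sub_eq_zero] using hb)
        rw [← enorm_neg (b - a), neg_sub, ← mul_assoc (v a ^ 2 * _), ← mul_assoc (v b ^ 2 * _),
          ← add_mul]
        gcongr
    _ = ∫⁻ a, (C * v a ^ 2 + ∫⁻ b, v b ^ 2 * (‖b - c‖ₑ⁻¹) ^ (-1 / 4 : ℝ) *
          ((‖a - c‖ₑ⁻¹) ^ (3 / 4 : ℝ) * (‖b - a‖ₑ⁻¹) ^ (1 / 2 : ℝ))) := by
        refine lintegral_congr_ae ?_
        filter_upwards [key] with a ha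
        rw [lintegral_add_left (by fun_prop), ha]
    _ = (C * ∫⁻ a, v a ^ 2) + ∫⁻ b, ∫⁻ a, v b ^ 2 * (‖b - c‖ₑ⁻¹) ^ (-1 / 4 : ℝ) *
          ((‖a - c‖ₑ⁻¹) ^ (3 / 4 : ℝ) * (‖b - a‖ₑ⁻¹) ^ (1 / 2 : ℝ)) := by
        rw [lintegral_add_left (by fun_prop), lintegral_const_mul _ (by fun_prop),
          lintegral_lintegral_swap (by fun_prop)]
    _ = _ := by
        rw [lintegral_congr_ae key, lintegral_const_mul _ (by fun_prop)]
        ring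

theorem sq_lintegral_half_kernel_le {v : ℝ → ℝ≥0∞} (hv : Measurable v) {a b : ℝ} (hab : a ≠ b) :
    (∫⁻ c, v c * ((‖a - c‖ₑ⁻¹) ^ (1 / 2 : ℝ) * (‖c - b‖ₑ⁻¹) ^ (1 / 2 : ℝ))) ^ 2 ≤
    (∫⁻ x : ℝ, (‖x‖ₑ⁻¹) ^ (3 / 4 : ℝ) * (‖x - 1‖ₑ⁻¹) ^ (3 / 4 : ℝ)) * (‖a - b‖ₑ⁻¹) ^ (1 / 2 : ℝ) *
      ∫⁻ c, v c ^ 2 * ((‖a - c‖ₑ⁻¹) ^ (1 / 4 : ℝ) * (‖b - c‖ₑ⁻¹) ^ (1 / 4 : ℝ)) := by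
  have h2 : ∀ (X : ℝ≥0∞) (r s : ℝ), r * 2 = s → (X ^ r) ^ (2 : ℝ) = X ^ s := fun X r s hrs => by
    rw [← ENNReal.rpow_mul, hrs]
  have hh : (2 : ℝ).HolderConjugate 2 := Real.HolderConjugate.two_two
  have h := ENNReal.lintegral_mul_le_Lp_mul_Lq volume hh
    (f := fun c => v c * ((‖a - c‖ₑ⁻¹) ^ (1 / 8 : ℝ) * (‖c - b‖ₑ⁻¹) ^ (1 / 8 : ℝ)))
    (g := fun c => (‖a - c‖ₑ⁻¹) ^ (3 / 8 : ℝ) * (‖c - b‖ₑ⁻¹) ^ (3 / 8 : ℝ))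
    (by fun_prop) (by fun_prop)
  simp only [Pi.mul_apply, ENNReal.mul_rpow_of_nonneg _ _ zero_le_two,
    h2 _ (1 / 8) (1 / 4) (by norm_num), h2 _ (3 / 8) (3 / 4) (by norm_num)] at h
  have h3 : ∫⁻ c, (‖a - c‖ₑ⁻¹) ^ (3 / 4 : ℝ) * (‖c - b‖ₑ⁻¹) ^ (3 / 4 : ℝ) =
      (‖a - b‖ₑ⁻¹) ^ (1 / 2 : ℝ) *
      ∫⁻ x : ℝ, (‖x‖ₑ⁻¹) ^ (3 / 4 : ℝ) * (‖x - 1‖ₑ⁻¹) ^ (3 / 4 : ℝ) := by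
    have := lintegral_inv_rpow_sub_mul_eq (p := 3 / 4) (q := 3 / 4) (by norm_num) (by norm_num)
      hab.symm
    simp_rw [mul_comm ((‖a - _‖ₑ⁻¹) ^ (3 / 4 : ℝ))]
    rw [this]; norm_num
  rw [h3] at h
  have e : ∀ c, v c * ((‖a - c‖ₑ⁻¹) ^ (1 / 8 : ℝ) * (‖c - b‖ₑ⁻¹) ^ (1 / 8 : ℝ)) *
      ((‖a - c‖ₑ⁻¹) ^ (3 / 8 : ℝ) * (‖c - b‖ₑ⁻¹) ^ (3 / 8 : ℝ)) =
      v c * ((‖a - c‖ₑ⁻¹) ^ (1 / 2 : ℝ) * (‖c - b‖ₑ⁻¹) ^ (1 / 2 : ℝ)) := fun c => by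
    rw [show (1 / 2 : ℝ) = 1 / 8 + 3 / 8 by norm_num,
      ENNReal.rpow_add_of_nonneg _ _ (by norm_num) (by norm_num),
      ENNReal.rpow_add_of_nonneg _ _ (by norm_num) (by norm_num)]
    ring
  simp_rw [e] at h
  refine (pow_le_pow_left' h 2).trans (le_of_eq ?_)
  have h5 : ∀ X : ℝ≥0∞, (X ^ (1 / 2 : ℝ)) ^ 2 = X := fun X => by
    rw [← ENNReal.rpow_natCast, ← ENNReal.rpow_mul]; norm_num
  rw [mul_pow, h5, h5, mul_comm, mul_comm (_ ^ _)]
  congr 1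
  refine lintegral_congr fun c => ?_
  rw [← enorm_neg (c - b), neg_sub, ENNReal.rpow_ofNat]

theorem exists_four_cycle_bound : ∃ C : ℝ≥0∞, C ≠ ∞ ∧ ∀ v : ℝ → ℝ≥0∞, Measurable v →
    ∫⁻ p : ℝ × ℝ, ∫⁻ q : ℝ × ℝ, v p.1 * v p.2 * (v q.1 * v q.2) *
      ((‖p.1 - p.2‖ₑ⁻¹) ^ (1 / 2 : ℝ) * (‖q.1 - q.2‖ₑ⁻¹) ^ (1 / 2 : ℝ) *
      ((‖p.1 - q.1‖ₑ⁻¹) ^ (1 / 2 : ℝ) * (‖p.2 - q.2‖ₑ⁻¹) ^ (1 / 2 : ℝ))) ≤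
    C * (∫⁻ t, v t ^ 2) ^ 2 := by
  set C₁ := ∫⁻ x : ℝ, (‖x‖ₑ⁻¹) ^ (3 / 4 : ℝ) * (‖x - 1‖ₑ⁻¹) ^ (3 / 4 : ℝ)
  set C₂ := ∫⁻ x : ℝ, (‖x‖ₑ⁻¹) ^ (3 / 4 : ℝ) * (‖x - 1‖ₑ⁻¹) ^ (1 / 2 : ℝ)
  have hC₁ : C₁ < ∞ := lintegral_inv_rpow_mul_lt_top (by norm_num) (by norm_num) (by norm_num)
    (by norm_num) (by norm_num)
  have hC₂ : C₂ < ∞ := lintegral_inv_rpow_mul_lt_top (by norm_num) (by norm_num) (by norm_num)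
    (by norm_num) (by norm_num)
  refine ⟨C₁ * (2 * C₂), (ENNReal.mul_lt_top hC₁ (ENNReal.mul_lt_top (by simp) hC₂)).ne,
    fun v hv => ?_⟩
  set k : ℝ → ℝ≥0∞ := fun x => (‖x‖ₑ⁻¹) ^ (1 / 2 : ℝ) with hk
  set κ : ℝ → ℝ≥0∞ := fun x => (‖x‖ₑ⁻¹) ^ (1 / 4 : ℝ) with hκ
  have hkm : Measurable k := by fun_prop
  have hκm : Measurable κ := by fun_prop
  calc _ = ∫⁻ p : ℝ × ℝ, ∫⁻ q : ℝ × ℝ, v p.1 * v p.2 * (v q.1 * v q.2) *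
      (k (p.1 - p.2) * k (q.1 - q.2) * (k (p.1 - q.1) * k (p.2 - q.2))) := rfl
    _ = ∫⁻ a, ∫⁻ c, ∫⁻ d, ∫⁻ b, v a * v c * (v d * v b) *
      (k (a - c) * k (d - b) * (k (a - d) * k (c - b))) := by
        rw [Measure.volume_eq_prod, lintegral_prod _ (by fun_prop)]
        refine lintegral_congr fun a => lintegral_congr fun c => ?_
        rw [lintegral_prod _ (by fun_prop)]
    _ = ∫⁻ a, ∫⁻ b, ∫⁻ c, ∫⁻ d, v a * v c * (v d * v b) *
      (k (a - c) * k (d - b) * (k (a - d) * k (c - b))) := by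
        refine lintegral_congr fun a => ?_
        have h : ∀ c, ∫⁻ d, ∫⁻ b, v a * v c * (v d * v b) *
            (k (a - c) * k (d - b) * (k (a - d) * k (c - b))) =
            ∫⁻ b, ∫⁻ d, v a * v c * (v d * v b) *
            (k (a - c) * k (d - b) * (k (a - d) * k (c - b))) :=
          fun c => lintegral_lintegral_swap (by fun_prop)
        simp_rw [h]
        have hM : Measurable fun z : ℝ × ℝ => ∫⁻ d, v a * v z.1 * (v d * v z.2) *
            (k (a - z.1) * k (d - z.2) * (k (a - d) * k (z.1 - z.2))) :=
          Measurable.lintegral_prod_right' (f := fun z : (ℝ × ℝ) × ℝ =>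
            v a * v z.1.1 * (v z.2 * v z.1.2) *
            (k (a - z.1.1) * k (z.2 - z.1.2) * (k (a - z.2) * k (z.1.1 - z.1.2)))) (by fun_prop)
        exact lintegral_lintegral_swap hM.aemeasurable
    _ = ∫⁻ a, ∫⁻ b, v a * v b * (∫⁻ c, v c * (k (a - c) * k (c - b))) ^ 2 := by
        refine lintegral_congr fun a => lintegral_congr fun b => ?_
        rw [sq, ← lintegral_mul_const _ (by fun_prop), ← lintegral_const_mul _ (by fun_prop)]
        refine lintegral_congr fun c => ?_
        rw [← lintegral_const_mul _ (by fun_prop), ← lintegral_const_mul _ (by fun_prop)]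
        refine lintegral_congr fun d => ?_
        ring
    _ ≤ ∫⁻ a, ∫⁻ b, v a * v b * (C₁ * k (a - b) * ∫⁻ c, v c ^ 2 * (κ (a - c) * κ (b - c))) := by
        refine lintegral_mono fun a => lintegral_mono_ae ?_
        filter_upwards [Measure.ae_ne volume a] with b hb
        gcongr
        exact sq_lintegral_half_kernel_le hv hb.symm
    _ = ∫⁻ a, ∫⁻ b, ∫⁻ c, C₁ * v c ^ 2 * (v a * v b * (κ (a - c) * κ (b - c)) * k (a - b)) := by
        refine lintegral_congr fun a => lintegral_congr fun b => ?_
        rw [← lintegral_const_mul _ (by fun_prop), ← lintegral_const_mul _ (by fun_prop)]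
        refine lintegral_congr fun c => ?_
        ring
    _ = ∫⁻ c, ∫⁻ a, ∫⁻ b, C₁ * v c ^ 2 * (v a * v b * (κ (a - c) * κ (b - c)) * k (a - b)) := by
        have h : ∀ a, ∫⁻ b, ∫⁻ c, C₁ * v c ^ 2 * (v a * v b * (κ (a - c) * κ (b - c)) * k (a - b)) =
            ∫⁻ c, ∫⁻ b, C₁ * v c ^ 2 * (v a * v b * (κ (a - c) * κ (b - c)) * k (a - b)) :=
          fun a => lintegral_lintegral_swap (by fun_prop)
        simp_rw [h]
        have hM : Measurable fun z : ℝ × ℝ => ∫⁻ b, C₁ * v z.2 ^ 2 *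
            (v z.1 * v b * (κ (z.1 - z.2) * κ (b - z.2)) * k (z.1 - b)) :=
          Measurable.lintegral_prod_right' (f := fun z : (ℝ × ℝ) × ℝ => C₁ * v z.1.2 ^ 2 *
            (v z.1.1 * v z.2 * (κ (z.1.1 - z.1.2) * κ (z.2 - z.1.2)) * k (z.1.1 - z.2)))
            (by fun_prop)
        exact lintegral_lintegral_swap hM.aemeasurable
    _ = ∫⁻ c, C₁ * v c ^ 2 * ∫⁻ a, ∫⁻ b, v a * v b * (κ (a - c) * κ (b - c)) * k (a - b) := by
        refine lintegral_congr fun c => ?_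
        rw [← lintegral_const_mul _ (by fun_prop)]
        refine lintegral_congr fun a => ?_
        rw [← lintegral_const_mul _ (by fun_prop)]
    _ ≤ ∫⁻ c, C₁ * v c ^ 2 * (2 * C₂ * ∫⁻ a, v a ^ 2) := by
        gcongr with c
        exact steinWeiss_quarter_le hv c
    _ = _ := by
        rw [lintegral_mul_const _ (by fun_prop), lintegral_const_mul _ (by fun_prop)]
        ring

open scoped FourierTransform SchwartzMap in
theorem integral_fourierInv_fourier_smul_eq {V : Type*} [NormedAddCommGroup V]
    [InnerProductSpace ℝ V] [FiniteDimensional ℝ V] [MeasurableSpace V] [BorelSpace V]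
    {f : V → ℂ} (hf : Integrable f) (hf' : Integrable (𝓕 f)) (G : 𝓢(V, ℂ)) :
    ∫ x, 𝓕⁻ (𝓕 f) x • G x = ∫ x, f x • G x := by
  have hflip : (innerₗ V).flip = innerₗ V := by
    ext x y; simp
  have hc : Continuous fun p : V × V => (innerₗ V) p.1 p.2 := by simpa using by fun_prop
  have hc' : Continuous fun p : V × V => (-innerₗ V) p.1 p.2 := by simpa using by fun_prop
  have h1 := VectorFourier.integral_fourierIntegral_smul_eq_flip (μ := volume) (ν := volume)
    (L := -innerₗ V) Real.continuous_fourierChar hc' hf' (G.integrable (μ := volume))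
  have hflip' : (-innerₗ V).flip = -innerₗ V := by
    ext x y; simp [real_inner_comm]
  rw [hflip'] at h1
  have h2 := VectorFourier.integral_fourierIntegral_smul_eq_flip (μ := volume) (ν := volume)
    (L := innerₗ V) Real.continuous_fourierChar hc hf ((𝓕⁻ G).integrable (μ := volume))
  rw [hflip] at h2
  calc _ = ∫ x, 𝓕 f x • 𝓕⁻ (⇑G) x := h1
    _ = ∫ x, 𝓕 f x • (𝓕⁻ G : 𝓢(V, ℂ)) x := by rw [SchwartzMap.fourierInv_coe]
    _ = ∫ x, f x • 𝓕 (⇑(𝓕⁻ G : 𝓢(V, ℂ))) x := h2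
    _ = _ := by rw [← SchwartzMap.fourier_coe, FourierTransform.fourier_fourierInv_eq]

open scoped FourierTransform in
theorem fourierInv_fourier_ae_eq {V : Type*} [NormedAddCommGroup V]
    [InnerProductSpace ℝ V] [FiniteDimensional ℝ V] [MeasurableSpace V] [BorelSpace V]
    {f : V → ℂ} (hf : Integrable f) (hf' : Integrable (𝓕 f)) : 𝓕⁻ (𝓕 f) =ᵐ[volume] f := by
  have hc : Continuous (𝓕⁻ (𝓕 f)) := by
    rw [fourierInv_eq_fourier_comp_neg]
    exact VectorFourier.fourierIntegral_continuous Real.continuous_fourierChar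
      (by simpa using by fun_prop) hf'.comp_neg
  refine ae_eq_of_integral_contDiff_smul_eq hc.locallyIntegrable hf.locallyIntegrable
    fun g hg hgs => ?_
  have hgs' : HasCompactSupport fun x => (g x : ℂ) := hgs.comp_left (g := ((↑) : ℝ → ℂ)) (by simp)
  have : ∫ x, 𝓕⁻ (𝓕 f) x • (g x : ℂ) = ∫ x, f x • (g x : ℂ) :=
    integral_fourierInv_fourier_smul_eq hf hf'
      (hgs'.toSchwartzMap (Complex.ofRealCLM.contDiff.comp hg))
  simpa [mul_comm] using this

open scoped FourierTransform in
theorem integral_fourier_mul_conj_fourier {V : Type*} [NormedAddCommGroup V]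
    [InnerProductSpace ℝ V] [FiniteDimensional ℝ V] [MeasurableSpace V] [BorelSpace V]
    {f g : V → ℂ} (hf : Integrable f) (hg : Integrable g) (hf' : Integrable (𝓕 f)) :
    ∫ x, 𝓕 f x * starRingEnd ℂ (𝓕 g x) = ∫ x, f x * starRingEnd ℂ (g x) := by
  have hc : Continuous fun p : V × V => (innerₗ V) p.1 p.2 := by simpa using by fun_prop
  have hflip : (innerₗ V).flip = innerₗ V := by
    ext x y; simp
  have h := VectorFourier.integral_sesq_fourierIntegral_eq_neg_flip (μ := volume) (ν := volume)
    (L := innerₗ V) (innerSL ℂ) Real.continuous_fourierChar hc hg hf'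
  rw [hflip] at h
  have h' : ∫ x, inner ℂ (𝓕 g x) (𝓕 f x) = ∫ x, inner ℂ (g x) (𝓕⁻ (𝓕 f) x) := h
  simp only [RCLike.inner_apply] at h'
  rw [h']
  refine integral_congr_ae ?_
  filter_upwards [fourierInv_fourier_ae_eq hf hf'] with x hx
  rw [hx]

open scoped FourierTransform in
theorem memLp_two_fourier {V : Type*} [NormedAddCommGroup V]
    [InnerProductSpace ℝ V] [FiniteDimensional ℝ V] [MeasurableSpace V] [BorelSpace V]
    {f : V → ℂ} (hf' : Integrable (𝓕 f)) : MemLp (𝓕 f) 2 volume := by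
  rw [memLp_two_iff_integrable_sq_norm hf'.aestronglyMeasurable]
  refine (hf'.norm.const_mul (∫ x, ‖f x‖)).mono (hf'.aestronglyMeasurable.norm.pow 2)
    (ae_of_all _ fun x => ?_)
  have h0 : 0 ≤ ∫ x, ‖f x‖ := integral_nonneg fun x => norm_nonneg _
  rw [norm_pow, norm_norm, norm_mul, norm_norm, Real.norm_of_nonneg h0, sq]
  gcongr
  exact VectorFourier.norm_fourierIntegral_le_integral_norm _ _ _ _ _

section WavePacket

variable {V : Type*} [NormedAddCommGroup V] [InnerProductSpace ℝ V]

/-- The Gaussian-regularised plane wave `η ↦ e^{-i(2π⟨x, η⟩ - 4π²t‖η‖²) - ε‖η‖²}`. -/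
def wavePacket (ε t : ℝ) (x η : V) : ℂ :=
  Complex.exp (-(ε - 4 * π ^ 2 * t * Complex.I) * (‖η‖ : ℂ) ^ 2 +
    (-2 * π * Complex.I) * (inner ℝ x η : ℝ))

theorem conj_wavePacket (ε t : ℝ) (x η : V) : starRingEnd ℂ (wavePacket ε t x η) =
    Complex.exp (-(ε + 4 * π ^ 2 * t * Complex.I) * (‖η‖ : ℂ) ^ 2 +
    (2 * π * Complex.I) * (inner ℝ x η : ℝ)) := by
  rw [wavePacket, ← Complex.exp_conj]
  congr 1
  simp only [map_add, map_mul, map_neg, map_sub, map_pow, Complex.conj_ofReal, Complex.conj_I,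
    Complex.conj_ofNat]
  ring

theorem norm_wavePacket (ε t : ℝ) (x η : V) : ‖wavePacket ε t x η‖ = Real.exp (-ε * ‖η‖ ^ 2) := by
  rw [wavePacket, Complex.norm_exp]
  congr 1
  have : -(ε - 4 * π ^ 2 * t * Complex.I) * (‖η‖ : ℂ) ^ 2 +
      (-2 * π * Complex.I) * (inner ℝ x η : ℝ) = ((-ε * ‖η‖ ^ 2 : ℝ) : ℂ) +
      ((4 * π ^ 2 * t * ‖η‖ ^ 2 - 2 * π * (inner ℝ x η : ℝ) : ℝ) : ℂ) * Complex.I := by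
    push_cast; ring
  rw [this]
  simp [-Complex.ofReal_mul, -Complex.ofReal_sub, -Complex.ofReal_pow]

@[fun_prop]
theorem continuous_wavePacket {Z : Type*} [TopologicalSpace Z] (ε : ℝ) {t : Z → ℝ} {x η : Z → V}
    (ht : Continuous t) (hx : Continuous x) (hη : Continuous η) :
    Continuous fun z => wavePacket ε (t z) (x z) (η z) := by
  unfold wavePacket
  fun_prop

theorem conj_wavePacket_mul (ε t s : ℝ) (x y η : V) :
    starRingEnd ℂ (wavePacket ε t x η) * wavePacket ε s y η =
      Complex.exp (-(2 * ε + 4 * π ^ 2 * (t - s) * Complex.I) * (‖η‖ : ℂ) ^ 2 +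
        (2 * π * Complex.I) * (inner ℝ (x - y) η : ℝ)) := by
  rw [conj_wavePacket, wavePacket, ← Complex.exp_add, inner_sub_left]
  congr 1
  push_cast; ring

theorem norm_conj_wavePacket_mul_le {ε : ℝ} (hε : 0 ≤ ε) (t : ℝ) (x η : V) (z : ℂ) :
    ‖starRingEnd ℂ (wavePacket ε t x η) * z‖ ≤ ‖z‖ := by
  rw [norm_mul, RCLike.norm_conj, norm_wavePacket]
  refine mul_le_of_le_one_left (norm_nonneg _) (Real.exp_le_one_iff.2 ?_)
  nlinarith [mul_nonneg hε (sq_nonneg ‖η‖)]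

variable [FiniteDimensional ℝ V] [MeasurableSpace V] [BorelSpace V]

theorem integrable_rexp_neg_mul_sq_norm {ε : ℝ} (hε : 0 < ε) :
    Integrable fun η : V => Real.exp (-ε * ‖η‖ ^ 2) := by
  have := (GaussianFourier.integrable_cexp_neg_mul_sq_norm_add (V := V) (b := ε)
    (by simpa using hε) 0 0).norm
  simpa [Complex.norm_exp, ← Complex.ofReal_pow] using this

theorem memLp_wavePacket {ε : ℝ} (hε : 0 < ε) (t : ℝ) (x : V) :
    MemLp (wavePacket ε t x) 2 volume := by
  have hc : Continuous (wavePacket ε t x) := by fun_prop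
  rw [memLp_two_iff_integrable_sq_norm hc.aestronglyMeasurable]
  simp_rw [norm_wavePacket, ← Real.exp_nat_mul]
  refine (integrable_rexp_neg_mul_sq_norm (ε := 2 * ε) (by positivity)).congr
    (ae_of_all _ fun η => ?_)
  dsimp only
  congr 1; push_cast; ring

/-- The Gaussian-regularised plane wave as an element of `L²`. -/
def wavePacketLp {ε : ℝ} (hε : 0 < ε) (t : ℝ) (x : V) : Lp ℂ 2 (volume : Measure V) :=
  (memLp_wavePacket hε t x).toLp

theorem inner_wavePacketLp_toLp {ε : ℝ} (hε : 0 < ε) (t : ℝ) (x : V) {φ : V → ℂ}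
    (hφ : MemLp φ 2 volume) :
    inner ℂ (wavePacketLp hε t x) hφ.toLp = ∫ η, starRingEnd ℂ (wavePacket ε t x η) * φ η := by
  rw [L2.inner_def]
  refine integral_congr_ae ?_
  filter_upwards [(memLp_wavePacket hε t x).coeFn_toLp, hφ.coeFn_toLp] with η h1 h2
  rw [wavePacketLp, h1, h2, RCLike.inner_apply, mul_comm]

theorem inner_wavePacketLp {ε : ℝ} (hε : 0 < ε) (t s : ℝ) (x y : V) :
    inner ℂ (wavePacketLp hε t x) (wavePacketLp hε s y) =
      ∫ η, starRingEnd ℂ (wavePacket ε t x η) * wavePacket ε s y η :=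
  inner_wavePacketLp_toLp hε t x (memLp_wavePacket hε s y)

theorem norm_wavePacketLp_sq {ε : ℝ} (hε : 0 < ε) (t : ℝ) (x : V) :
    ‖wavePacketLp hε t x‖ ^ 2 = ∫ η : V, Real.exp (-(2 * ε) * ‖η‖ ^ 2) := by
  have h := inner_wavePacketLp hε t t x x
  have h2 : ∀ η, starRingEnd ℂ (wavePacket ε t x η) * wavePacket ε t x η =
      ((Real.exp (-(2 * ε) * ‖η‖ ^ 2) : ℝ) : ℂ) := fun η => by
    rw [mul_comm, Complex.mul_conj, Complex.normSq_eq_norm_sq, norm_wavePacket, ← Real.exp_nat_mul]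
    congr 2; push_cast; ring
  simp_rw [h2] at h
  rw [inner_self_eq_norm_sq_to_K, integral_complex_ofReal] at h
  apply Complex.ofReal_injective
  rw [← h]
  push_cast
  rfl

theorem continuous_wavePacketLp {ε : ℝ} (hε : 0 < ε) :
    Continuous fun z : ℝ × V => wavePacketLp hε z.1 z.2 := by
  rw [continuous_iff_continuousAt]
  intro w
  rw [ContinuousAt, tendsto_iff_norm_sub_tendsto_zero]
  have hgram : Continuous fun z : ℝ × V =>
      RCLike.re (inner ℂ (wavePacketLp hε z.1 z.2) (wavePacketLp hε w.1 w.2)) := by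
    simp_rw [inner_wavePacketLp]
    refine RCLike.continuous_re.comp (continuous_of_dominated
      (bound := fun η => Real.exp (-(2 * ε) * ‖η‖ ^ 2)) (fun z => ?_) (fun z => ?_)
      (integrable_rexp_neg_mul_sq_norm (by positivity)) (ae_of_all _ fun η => ?_))
    · exact Continuous.aestronglyMeasurable
        ((Complex.continuous_conj.comp (by fun_prop)).mul (by fun_prop))
    · refine ae_of_all _ fun η => le_of_eq ?_
      rw [norm_mul, RCLike.norm_conj, norm_wavePacket, norm_wavePacket, ← Real.exp_add]
      congr 1; ring
    · exact (Complex.continuous_conj.comp (by fun_prop)).mul continuous_const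
  have hsq : Continuous fun z : ℝ × V => ‖wavePacketLp hε z.1 z.2 - wavePacketLp hε w.1 w.2‖ := by
    have : ∀ z : ℝ × V, ‖wavePacketLp hε z.1 z.2 - wavePacketLp hε w.1 w.2‖ =
        √(‖wavePacketLp hε w.1 w.2‖ ^ 2 -
          2 * RCLike.re (inner ℂ (wavePacketLp hε z.1 z.2) (wavePacketLp hε w.1 w.2)) +
          ‖wavePacketLp hε w.1 w.2‖ ^ 2) := fun z => by
      rw [← Real.sqrt_sq (norm_nonneg (wavePacketLp hε z.1 z.2 - wavePacketLp hε w.1 w.2)),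
        @norm_sub_sq ℂ, norm_wavePacketLp_sq, norm_wavePacketLp_sq]
    simp_rw [this]
    fun_prop
  simpa using hsq.tendsto w

theorem enorm_inner_wavePacketLp_le (hV : Module.finrank ℝ V = 1) {ε : ℝ} (hε : 0 < ε) {t s : ℝ}
    (x y : V) :
    ‖inner ℂ (wavePacketLp hε t x) (wavePacketLp hε s y)‖ₑ ≤ (‖t - s‖ₑ⁻¹) ^ (1 / 2 : ℝ) := by
  rcases eq_or_ne t s with rfl | hts
  · simp
  set b : ℂ := 2 * ε + 4 * π ^ 2 * (t - s) * Complex.I with hb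
  have hb' : b = ((2 * ε : ℝ) : ℂ) + ((4 * π ^ 2 * (t - s) : ℝ) : ℂ) * Complex.I := by
    rw [hb]; push_cast; ring
  have hre : b.re = 2 * ε := by
    rw [hb', Complex.add_re, Complex.ofReal_re, Complex.re_ofReal_mul]; simp
  have him : b.im = 4 * π ^ 2 * (t - s) := by
    rw [hb', Complex.add_im, Complex.ofReal_im, Complex.im_ofReal_mul]; simp
  have hbre : 0 < b.re := by rw [hre]; positivity
  rw [inner_wavePacketLp]
  simp_rw [conj_wavePacket_mul]
  rw [GaussianFourier.integral_cexp_neg_mul_sq_norm_add hbre, hV]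
  have hts' : 0 < |t - s| := abs_pos.2 (sub_ne_zero.2 hts)
  have hbn : |t - s| ≤ ‖b‖ / π := by
    rw [le_div_iff₀ pi_pos]
    refine le_trans ?_ (Complex.abs_im_le_norm b)
    rw [him, abs_mul, abs_of_nonneg (by positivity : (0 : ℝ) ≤ 4 * π ^ 2), mul_comm]
    gcongr
    nlinarith [pi_gt_three]
  have hbn0 : 0 < ‖b‖ := (norm_pos_iff.2 fun h => by simp [h] at hbre)
  have h1 : ‖((π : ℂ) / b) ^ ((1 : ℕ) / 2 : ℂ)‖ ≤ (|t - s|⁻¹) ^ (1 / 2 : ℝ) := by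
    rw [show (((1 : ℕ) : ℂ) / 2) = ((1 / 2 : ℝ) : ℂ) by push_cast; ring,
      Complex.norm_cpow_real]
    gcongr
    rw [norm_div, Complex.norm_real, Real.norm_of_nonneg pi_pos.le]
    rw [← inv_div]
    gcongr
  have h2 : ‖Complex.exp ((2 * π * Complex.I) ^ 2 * (‖x - y‖ : ℂ) ^ 2 / (4 * b))‖ ≤ 1 := by
    rw [Complex.norm_exp, Real.exp_le_one_iff]
    have : (2 * π * Complex.I) ^ 2 * (‖x - y‖ : ℂ) ^ 2 / (4 * b) =
        ((-(π ^ 2 * ‖x - y‖ ^ 2) : ℝ) : ℂ) * b⁻¹ := by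
      have : b ≠ 0 := norm_pos_iff.1 hbn0
      rw [mul_pow, mul_pow, Complex.I_sq]
      push_cast
      field_simp
      ring
    rw [this, Complex.re_ofReal_mul, Complex.inv_re]
    have := div_nonneg hbre.le (Complex.normSq_nonneg b)
    nlinarith [mul_nonneg (by positivity : 0 ≤ π ^ 2 * ‖x - y‖ ^ 2) this]
  rw [← ofReal_norm, norm_mul, Real.enorm_eq_ofReal_abs, ← ENNReal.ofReal_inv_of_pos hts',
    ENNReal.ofReal_rpow_of_nonneg (by positivity) (by norm_num)]
  refine ENNReal.ofReal_le_ofReal ?_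
  calc _ ≤ (|t - s|⁻¹) ^ (1 / 2 : ℝ) * 1 := by gcongr
    _ = _ := mul_one _

end WavePacket

section FreeWave

variable {V : Type*} [NormedAddCommGroup V] [InnerProductSpace ℝ V] [FiniteDimensional ℝ V]
  [MeasurableSpace V] [BorelSpace V]

/-- The free Schrödinger wave `e^{itΔ}f` in terms of the Fourier transform `φ = 𝓕 f`. -/
def freeWave (φ : V → ℂ) (t : ℝ) (x : V) : ℂ :=
  ∫ η, starRingEnd ℂ (wavePacket 0 t x η) * φ η

theorem aestronglyMeasurable_conj_wavePacket_mul {φ : V → ℂ} (hφ : AEStronglyMeasurable φ volume)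
    (ε t : ℝ) (x : V) :
    AEStronglyMeasurable (fun η => starRingEnd ℂ (wavePacket ε t x η) * φ η) volume :=
  (Complex.continuous_conj.comp (by fun_prop)).aestronglyMeasurable.mul hφ

theorem continuous_freeWave {φ : V → ℂ} (hφ : Integrable φ) :
    Continuous fun z : ℝ × V => freeWave φ z.1 z.2 :=
  continuous_of_dominated (bound := fun η => ‖φ η‖)
    (fun _ => aestronglyMeasurable_conj_wavePacket_mul hφ.1 _ _ _)
    (fun _ => ae_of_all _ fun _ => norm_conj_wavePacket_mul_le le_rfl _ _ _ _) hφ.norm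
    (ae_of_all _ fun _ => (Complex.continuous_conj.comp (by fun_prop)).mul continuous_const)

theorem norm_integral_conj_wavePacket_mul_le {φ : V → ℂ} (hφ : Integrable φ) {ε : ℝ} (hε : 0 ≤ ε)
    (t : ℝ) (x : V) : ‖∫ η, starRingEnd ℂ (wavePacket ε t x η) * φ η‖ ≤ ∫ η, ‖φ η‖ :=
  norm_integral_le_of_norm_le hφ.norm
    (ae_of_all _ fun η => norm_conj_wavePacket_mul_le hε t x η (φ η))

theorem norm_freeWave_le {φ : V → ℂ} (hφ : Integrable φ) (t : ℝ) (x : V) :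
    ‖freeWave φ t x‖ ≤ ∫ η, ‖φ η‖ :=
  norm_integral_conj_wavePacket_mul_le hφ le_rfl t x

open Filter Topology in
theorem tendsto_integral_conj_wavePacket_mul {φ : V → ℂ} (hφ : Integrable φ) {ε : ℕ → ℝ}
    (hε : ∀ n, 0 ≤ ε n) (hε0 : Tendsto ε atTop (𝓝 0)) (t : ℝ) (x : V) :
    Tendsto (fun n => ∫ η, starRingEnd ℂ (wavePacket (ε n) t x η) * φ η) atTop
      (𝓝 (freeWave φ t x)) := by
  refine tendsto_integral_of_dominated_convergence (fun η => ‖φ η‖)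
    (fun _ => aestronglyMeasurable_conj_wavePacket_mul hφ.1 _ _ _) hφ.norm
    (fun n => ae_of_all _ fun η => norm_conj_wavePacket_mul_le (hε n) t x η (φ η))
    (ae_of_all _ fun η => ?_)
  have hc : Continuous fun e : ℝ => starRingEnd ℂ (wavePacket e t x η) * φ η := by
    unfold wavePacket
    exact (Complex.continuous_conj.comp (by fun_prop)).mul continuous_const
  exact (hc.tendsto 0).comp hε0

theorem stronglyMeasurable_wavePacketLp {ε : ℝ} (hε : 0 < ε) {x : ℝ → V} (hx : Measurable x) :
    StronglyMeasurable fun t => wavePacketLp hε t (x t) :=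
  (continuous_wavePacketLp hε).comp_stronglyMeasurable (f := fun t => (t, x t))
    (g := fun z : ℝ × V => wavePacketLp hε z.1 z.2) (measurable_id.prodMk hx).stronglyMeasurable

theorem stronglyMeasurable_smul_wavePacketLp {ε : ℝ} (hε : 0 < ε) {x : ℝ → V} (hx : Measurable x)
    {w : ℝ → ℝ} (hw : Measurable w) :
    StronglyMeasurable fun t => (w t : ℂ) • wavePacketLp hε t (x t) := by
  have h1 : StronglyMeasurable fun t => (w t : ℂ) :=
    (Complex.measurable_ofReal.comp hw).stronglyMeasurable
  exact h1.smul (stronglyMeasurable_wavePacketLp hε hx)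

theorem exists_wavePacketLp_bound (hV : Module.finrank ℝ V = 1) :
    ∃ C : ℝ≥0∞, C ≠ ∞ ∧ ∀ {ε : ℝ} (hε : 0 < ε) {x : ℝ → V} {w : ℝ → ℝ}, Measurable x →
      Measurable w → Integrable (fun t => w t ^ 2) →
      ∀ {ι : Type} {e : ι → Lp ℂ 2 (volume : Measure V)},
      Orthonormal ℂ e → ∀ s : Finset ι,
      ENNReal.ofReal (∑ j ∈ s, (∫ t, w t ^ 2 * ‖inner ℂ (wavePacketLp hε t (x t)) (e j)‖ ^ 2) ^ 4) ≤
        C * (∫⁻ t, (‖w t‖ₑ ^ 2) ^ 2) ^ 2 := by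
  obtain ⟨C, hC, hb⟩ := exists_four_cycle_bound
  refine ⟨C, hC, ?_⟩
  intro ε hε x w hx hw hwi ι e he s
  set h : ℝ → Lp ℂ 2 (volume : Measure V) := fun t => (w t : ℂ) • wavePacketLp hε t (x t) with hh
  have hm : StronglyMeasurable h := stronglyMeasurable_smul_wavePacketLp hε hx hw
  have hi : Integrable fun t => ‖h t‖ ^ 2 := by
    simp_rw [hh, norm_smul, mul_pow, norm_wavePacketLp_sq, Complex.norm_real, Real.norm_eq_abs,
      sq_abs]
    exact hwi.mul_const _
  have key := L2.sum_integral_norm_inner_sq_pow_four_le volume hm hi he s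
  have hin : ∀ t s, ‖inner ℂ (h t) (h s)‖ₑ ≤
      ‖w t‖ₑ * ‖w s‖ₑ * (‖t - s‖ₑ⁻¹) ^ (1 / 2 : ℝ) := fun t s => by
    simp only [hh]
    rw [inner_smul_left, inner_smul_right, enorm_mul, enorm_mul, RCLike.enorm_conj, ← mul_assoc,
      ← ofReal_norm, ← ofReal_norm, Complex.norm_real, Complex.norm_real, ofReal_norm, ofReal_norm]
    gcongr
    exact enorm_inner_wavePacketLp_le hV hε _ _
  refine le_trans (le_of_eq ?_) (key.trans (le_trans ?_ (hb (fun t => ‖w t‖ₑ ^ 2) (by fun_prop))))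
  · congr 2 with j
    congr 2 with t
    simp only [hh]
    rw [inner_smul_left, norm_mul, RCLike.norm_conj, Complex.norm_real, mul_pow, Real.norm_eq_abs,
      sq_abs]
  · refine lintegral_mono fun p => lintegral_mono fun q => ?_
    calc _ ≤ ‖w p.1‖ₑ * ‖w p.2‖ₑ * (‖p.1 - p.2‖ₑ⁻¹) ^ (1 / 2 : ℝ) *
          (‖w q.1‖ₑ * ‖w q.2‖ₑ * (‖q.1 - q.2‖ₑ⁻¹) ^ (1 / 2 : ℝ)) *
          (‖w p.1‖ₑ * ‖w q.1‖ₑ * (‖p.1 - q.1‖ₑ⁻¹) ^ (1 / 2 : ℝ) *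
          (‖w p.2‖ₑ * ‖w q.2‖ₑ * (‖p.2 - q.2‖ₑ⁻¹) ^ (1 / 2 : ℝ))) := by
          gcongr <;> exact hin _ _
      _ = _ := by ring

theorem stronglyMeasurable_inner_wavePacketLp {ε : ℝ} (hε : 0 < ε) {x : ℝ → V}
    (hx : Measurable x) (e : Lp ℂ 2 (volume : Measure V)) :
    StronglyMeasurable fun t => (inner ℂ (wavePacketLp hε t (x t)) e : ℂ) :=
  Continuous.comp_stronglyMeasurable (f := fun t => wavePacketLp hε t (x t))
    (g := fun v : Lp ℂ 2 (volume : Measure V) => (inner ℂ v e : ℂ))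
    (Continuous.inner continuous_id continuous_const)
    (stronglyMeasurable_wavePacketLp hε hx)

open Filter Topology in
theorem tendsto_integral_norm_inner_wavePacketLp_sq {x : ℝ → V} {w : ℝ → ℝ} (hx : Measurable x)
    (hw : Measurable w) (hwi : Integrable fun t => w t ^ 2) {φ : V → ℂ} (hφi : Integrable φ)
    (hφ : MemLp φ 2 volume) {ε : ℕ → ℝ} (hε : ∀ n, 0 < ε n) (hε0 : Tendsto ε atTop (𝓝 0)) :
    Tendsto (fun n => ∫ t, w t ^ 2 * ‖(inner ℂ (wavePacketLp (hε n) t (x t)) hφ.toLp : ℂ)‖ ^ 2)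
      atTop (𝓝 (∫ t, w t ^ 2 * ‖freeWave φ t (x t)‖ ^ 2)) := by
  refine tendsto_integral_of_dominated_convergence
    (fun t => w t ^ 2 * (∫ η, ‖φ η‖) ^ 2) (fun n => ?_) (hwi.mul_const _)
    (fun n => ae_of_all _ fun t => ?_) (ae_of_all _ fun t => ?_)
  · have h1 := (stronglyMeasurable_inner_wavePacketLp (hε n) hx hφ.toLp).measurable
    exact ((hw.pow_const 2).mul (h1.norm.pow_const 2)).aestronglyMeasurable
  · rw [norm_mul, norm_pow, norm_pow, Real.norm_eq_abs, sq_abs, norm_norm,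
      inner_wavePacketLp_toLp]
    gcongr
    exact norm_integral_conj_wavePacket_mul_le hφi (hε n).le _ _
  · simp_rw [inner_wavePacketLp_toLp]
    exact ((tendsto_integral_conj_wavePacket_mul hφi (fun n => (hε n).le) hε0 t
      (x t)).norm.pow 2).const_mul _

theorem measurable_freeWave_comp {φ : V → ℂ} (hφ : Integrable φ) {x : ℝ → V} (hx : Measurable x) :
    Measurable fun t => freeWave φ t (x t) :=
  Measurable.comp (g := fun z : ℝ × V => freeWave φ z.1 z.2) (f := fun t => (t, x t))
    (continuous_freeWave hφ).measurable (measurable_id.prodMk hx)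

open Filter Topology in
theorem exists_freeWave_bound (hV : Module.finrank ℝ V = 1) :
    ∃ C : ℝ≥0∞, C ≠ ∞ ∧ ∀ {x : ℝ → V} {w : ℝ → ℝ}, Measurable x →
      Measurable w → Integrable (fun t => w t ^ 2) → ∀ {ι : Type} {φ : ι → V → ℂ},
      (∀ j, Integrable (φ j)) → ∀ hφ : ∀ j, MemLp (φ j) 2 volume,
      Orthonormal ℂ (fun j => (hφ j).toLp) → ∀ s : Finset ι,
      ∑ j ∈ s, (∫⁻ t, ‖w t‖ₑ ^ 2 * ‖freeWave (φ j) t (x t)‖ₑ ^ 2) ^ 4 ≤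
        C * (∫⁻ t, (‖w t‖ₑ ^ 2) ^ 2) ^ 2 := by
  obtain ⟨C, hC, hb⟩ := exists_wavePacketLp_bound hV
  refine ⟨C, hC, ?_⟩
  intro x w hx hw hwi ι φ hφi hφ ho s
  set ε : ℕ → ℝ := fun n => 1 / ((n : ℝ) + 1)
  have hε : ∀ n, 0 < ε n := fun n => by positivity
  have hε0 : Tendsto ε atTop (𝓝 0) := tendsto_one_div_add_atTop_nhds_zero_nat
  have hint : ∀ j, Integrable fun t => w t ^ 2 * ‖freeWave (φ j) t (x t)‖ ^ 2 := fun j =>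
    hwi.mul_bdd (c := (∫ η, ‖φ j η‖) ^ 2)
      ((measurable_freeWave_comp (hφi j) hx).norm.pow_const 2).aestronglyMeasurable
      (ae_of_all _ fun t => by
        rw [norm_pow, norm_norm]
        gcongr
        exact norm_freeWave_le (hφi j) _ _)
  have hlim : Tendsto (fun n => ENNReal.ofReal (∑ j ∈ s,
      (∫ t, w t ^ 2 * ‖inner ℂ (wavePacketLp (hε n) t (x t)) (hφ j).toLp‖ ^ 2) ^ 4)) atTop
      (𝓝 (ENNReal.ofReal (∑ j ∈ s, (∫ t, w t ^ 2 * ‖freeWave (φ j) t (x t)‖ ^ 2) ^ 4))) := by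
    exact (ENNReal.continuous_ofReal.tendsto _).comp (tendsto_finsetSum _ fun j _ =>
      (tendsto_integral_norm_inner_wavePacketLp_sq hx hw hwi (hφi j) (hφ j) hε hε0).pow 4)
  refine le_trans (le_of_eq ?_) (le_of_tendsto' hlim fun n => hb (hε n) hx hw hwi ho s)
  rw [ENNReal.ofReal_sum_of_nonneg fun j _ => by positivity]
  refine Finset.sum_congr rfl fun j _ => ?_
  rw [ENNReal.ofReal_pow (integral_nonneg fun t => by positivity),
    ofReal_integral_eq_lintegral_ofReal (hint j) (ae_of_all _ fun t => by positivity)]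
  congr 2 with t
  rw [ENNReal.ofReal_mul (by positivity), ENNReal.ofReal_pow (norm_nonneg _), ofReal_norm,
    ← sq_abs, ENNReal.ofReal_pow (abs_nonneg _), Real.enorm_eq_ofReal_abs]

end FreeWave

section Schrodinger

open FourierTransform

theorem FT_eq_fourier {n : ℕ} (f : Rn n → ℂ) (ξ : Rn n) :
    FT f ξ = 𝓕 f ((2 * π)⁻¹ • ξ) := by
  rw [FT, Real.fourier_eq']
  refine integral_congr_ae (ae_of_all _ fun x => ?_)
  simp only [smul_eq_mul]
  congr 2
  have : (inner ℝ x ((2 * π)⁻¹ • ξ) : ℝ) = (2 * π)⁻¹ * ∑ i, x i * ξ i := by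
    rw [inner_smul_right, PiLp.inner_apply]
    simp [mul_comm]
  rw [this, dotC, show -2 * π * ((2 * π)⁻¹ * ∑ i, x i * ξ i) = -∑ i, x i * ξ i by
    field_simp]
  push_cast
  ring

theorem schrodinger_eq_freeWave {n : ℕ} (f : Rn n → ℂ) (t : ℝ) (x : Rn n) :
    schrodinger f t x = freeWave (𝓕 f) t x := by
  have h2π : (2 * π : ℝ) ≠ 0 := by positivity
  have key := Measure.integral_comp_inv_smul_of_nonneg (volume : Measure (Rn n))
    (fun η => starRingEnd ℂ (wavePacket 0 t x η) * 𝓕 f η) (R := 2 * π) (by positivity)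
  rw [schrodinger, prop, freeWave, ← one_smul ℝ (∫ η, _ * 𝓕 f η),
    ← inv_mul_cancel₀ (pow_ne_zero (Module.finrank ℝ (Rn n)) h2π), mul_smul, ← key]
  congr 1
  · rw [Real.rpow_neg (by positivity), finrank_euclideanSpace_fin, Real.rpow_natCast]
  · refine integral_congr_ae (ae_of_all _ fun ξ => ?_)
    simp only [one_mul, FT_eq_fourier, conj_wavePacket]
    congr 2
    have : (inner ℝ x ((2 * π)⁻¹ • ξ) : ℝ) = (2 * π)⁻¹ * ∑ i, x i * ξ i := by
      rw [inner_smul_right, PiLp.inner_apply]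
      simp [mul_comm]
    rw [this, dotC, norm_smul, Real.norm_of_nonneg (by positivity)]
    have h2 : (π : ℂ) ≠ 0 := by exact_mod_cast Real.pi_ne_zero
    push_cast
    field_simp
    ring

theorem schrodinger_eq_zero {n : ℕ} {f : Rn n → ℂ}
    (hf : ¬ (Integrable f ∧ Integrable (𝓕 f))) (t : ℝ) (x : Rn n) : schrodinger f t x = 0 := by
  rw [schrodinger_eq_freeWave, freeWave]
  by_cases h : Integrable f
  · refine integral_undef fun hi => hf ⟨h, ?_⟩
    have hw : Continuous fun η => wavePacket 0 t x η := by fun_prop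
    refine (hi.bdd_mul (c := 1) hw.aestronglyMeasurable (ae_of_all _ fun η => ?_)).congr
      (ae_of_all _ fun η => ?_)
    · simp [norm_wavePacket]
    · simp only
      rw [← mul_assoc, Complex.mul_conj, Complex.normSq_eq_norm_sq, norm_wavePacket]
      simp
  · have : 𝓕 f = 0 := by
      ext η
      rw [Real.fourier_eq]
      exact integral_undef fun hi => h ((Real.fourierIntegral_convergent_iff η).1 hi)
    simp [this]

theorem orthonormal_toLp_fourier {n : ℕ} {f : ℕ → Rn n → ℂ} (hf : OrthonormalL2 f)
    {ι : Type*} {e : ι → ℕ} (he : Function.Injective e) (hi : ∀ j, Integrable (f (e j)))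
    (hi' : ∀ j, Integrable (𝓕 (f (e j)))) :
    Orthonormal ℂ fun j => (memLp_two_fourier (hi' j)).toLp := by
  classical
  rw [orthonormal_iff_ite]
  intro j k
  rw [L2.inner_def]
  have h1 := integral_fourier_mul_conj_fourier (hi k) (hi j) (hi' k)
  rw [hf (e k) (e j)] at h1
  rw [integral_congr_ae (g := fun x => 𝓕 (f (e k)) x * starRingEnd ℂ (𝓕 (f (e j)) x)), h1]
  · simp [he.eq_iff, eq_comm]
  · filter_upwards [(memLp_two_fourier (hi' j)).coeFn_toLp, (memLp_two_fourier (hi' k)).coeFn_toLp]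
      with x h1 h2
    rw [h1, h2]
    rfl

end Schrodinger

section Selection

variable {V : Type*} [MeasurableSpace V]

/-- A measurable choice of an approximate maximiser among finitely many points. -/
theorem exists_measurable_le_selection {F : ℝ → V → ℝ≥0∞}
    (hF : ∀ x : ℝ → V, Measurable x → Measurable fun t => F t (x t)) (q : ℕ → V) (N : ℕ) :
    ∃ x : ℝ → V, Measurable x ∧ ∀ t, ∀ i ≤ N, F t (q i) ≤ F t (x t) := by
  classical
  induction N with
  | zero => exact ⟨fun _ => q 0, measurable_const, fun t i hi => by simp [Nat.le_zero.1 hi]⟩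
  | succ N ih =>
    obtain ⟨x, hx, hmax⟩ := ih
    refine ⟨fun t => if F t (x t) ≤ F t (q (N + 1)) then q (N + 1) else x t,
      Measurable.ite (measurableSet_le (hF x hx) (hF _ measurable_const)) measurable_const hx,
      fun t i hi => ?_⟩
    rcases Nat.le_succ_iff.1 hi with hi | rfl <;> simp only
    · split_ifs with h
      exacts [(hmax t i hi).trans h, hmax t i hi]
    · split_ifs with h
      exacts [le_rfl, (not_le.1 h).le]

theorem le_sq_of_le_mul_rpow_half {K X : ℝ≥0∞} (hX : X ≠ ∞) (h : X ≤ K * X ^ (1 / 2 : ℝ)) :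
    X ≤ K ^ 2 := by
  rcases eq_or_ne X 0 with rfl | h0
  · simp
  have h1 : X = X ^ (1 / 2 : ℝ) * X ^ (1 / 2 : ℝ) := by
    rw [← ENNReal.rpow_add_of_nonneg _ _ (by norm_num) (by norm_num)]
    norm_num
  have h2 : X ^ (1 / 2 : ℝ) ≤ K := by
    refine (ENNReal.mul_le_mul_iff_left (a := X ^ (1 / 2 : ℝ)) ?_ ?_).1 (h1.symm.le.trans h)
    · simp [h0, hX]
    · simp [hX]
  calc X = (X ^ (1 / 2 : ℝ)) ^ 2 := by rw [sq, ← h1]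
    _ ≤ K ^ 2 := by gcongr

/-- Duality: a weighted `L¹` bound along every measurable curve controls the `L²` norm of the
supremum over finitely many points. -/
theorem setLIntegral_iSup_sq_le {F : ℝ → V → ℝ≥0∞} {B K : ℝ≥0∞} (hB : B ≠ ∞)
    (hFB : ∀ t x, F t x ≤ B)
    (hF : ∀ x : ℝ → V, Measurable x → Measurable fun t => F t (x t))
    (hK : ∀ (x : ℝ → V) (w : ℝ → ℝ), Measurable x → Measurable w →
      Integrable (fun t => w t ^ 2) → ∫⁻ t, ‖w t‖ₑ ^ 2 * F t (x t) ≤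
        K * (∫⁻ t, (‖w t‖ₑ ^ 2) ^ 2) ^ (1 / 2 : ℝ))
    (q : ℕ → V) (N : ℕ) {S : Set ℝ} (hS : MeasurableSet S) (hS' : volume S ≠ ∞) :
    ∫⁻ t in S, (⨆ i ≤ N, F t (q i)) ^ 2 ≤ K ^ 2 := by
  obtain ⟨x, hx, hmax⟩ := exists_measurable_le_selection hF q N
  set R : ℝ → ℝ≥0∞ := S.indicator fun t => F t (x t) with hR
  have hRm : Measurable R := (hF x hx).indicator hS
  have hRB : ∀ t, R t ≤ S.indicator (fun _ => B) t := fun t =>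
    Set.indicator_le_indicator (hFB t (x t))
  have hRt : ∀ t, R t ≠ ∞ := fun t =>
    (lt_of_le_of_lt (indicator_le_self' (fun _ _ => zero_le) t)
      ((hFB t (x t)).trans_lt hB.lt_top)).ne
  set w : ℝ → ℝ := fun t => √(R t).toReal with hw
  have hwm : Measurable w := hRm.ennreal_toReal.sqrt
  have hw2 : ∀ t, w t ^ 2 = (R t).toReal := fun t => Real.sq_sqrt toReal_nonneg
  have hwR : ∀ t, ‖w t‖ₑ ^ 2 = R t := fun t => by
    rw [← enorm_pow, hw2, Real.enorm_eq_ofReal toReal_nonneg, ofReal_toReal (hRt t)]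
  have hwi : Integrable fun t => w t ^ 2 := by
    simp_rw [hw2]
    refine integrable_toReal_of_lintegral_ne_top hRm.aemeasurable
      (ne_top_of_le_ne_top ?_ (lintegral_mono hRB))
    rw [lintegral_indicator_const hS]
    exact mul_ne_top hB hS'
  have hX : ∫⁻ t, R t ^ 2 ≠ ∞ := by
    have : ∀ t, R t ^ 2 ≤ S.indicator (fun _ => B ^ 2) t := fun t =>
      (pow_le_pow_left' (hRB t) 2).trans (by by_cases h : t ∈ S <;> simp [h])
    refine ne_top_of_le_ne_top ?_ (lintegral_mono this)
    rw [lintegral_indicator_const hS]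
    exact mul_ne_top (pow_ne_top hB) hS'
  have h1 := hK x w hx hwm hwi
  simp_rw [hwR] at h1
  rw [show (fun t => R t * F t (x t)) = fun t => R t ^ 2 by
    ext t; by_cases h : t ∈ S <;> simp [hR, h, sq]] at h1
  refine le_trans ?_ (le_sq_of_le_mul_rpow_half hX h1)
  rw [← lintegral_indicator hS]
  refine lintegral_mono fun t => ?_
  by_cases h : t ∈ S
  · simp only [h, indicator_of_mem, hR]
    gcongr
    exact iSup₂_le (hmax t)
  · simp [h]

end Selection

theorem ENNReal.sum_mul_le_of_sum_pow_four_le {ι : Type*} (s : Finset ι) (a D : ι → ℝ≥0∞)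
    {C Y : ℝ≥0∞} (h : ∑ j ∈ s, D j ^ 4 ≤ C * Y ^ 2) :
    ∑ j ∈ s, a j * D j ≤ C ^ (1 / 4 : ℝ) * (∑ j ∈ s, a j ^ (4 / 3 : ℝ)) ^ (3 / 4 : ℝ) *
      Y ^ (1 / 2 : ℝ) := by
  have hpq : (4 / 3 : ℝ).HolderConjugate 4 := by
    rw [Real.holderConjugate_iff]; norm_num
  refine (ENNReal.inner_le_Lp_mul_Lq s a D hpq).trans ?_
  calc _ ≤ (∑ j ∈ s, a j ^ (4 / 3 : ℝ)) ^ (3 / 4 : ℝ) * (C * Y ^ 2) ^ (1 / 4 : ℝ) := by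
        gcongr ?_ * ?_ ^ (1 / 4 : ℝ)
        · norm_num
        · exact_mod_cast h
    _ = _ := by
        rw [ENNReal.mul_rpow_of_nonneg _ _ (by norm_num), ← ENNReal.rpow_natCast_mul]
        norm_num
        ring

theorem ENNReal.rpow_sum_rpow_le_of_exponent_le {ι : Type*} (a : ι → ℝ≥0∞) (s : Finset ι)
    {p q : ℝ} (hp : 0 < p) (hpq : p ≤ q) :
    (∑ j ∈ s, a j ^ q) ^ (1 / q) ≤ (∑' j, a j ^ p) ^ (1 / p) := by
  have hq : 0 < q := hp.trans_le hpq
  set S := (∑' j, a j ^ p) ^ (1 / p) with hS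
  have hSp : ∑' j, a j ^ p = S ^ p := by
    rw [hS, ← ENNReal.rpow_mul, one_div_mul_cancel hp.ne', ENNReal.rpow_one]
  have ha : ∀ j, a j ≤ S := fun j => by
    rw [← ENNReal.rpow_le_rpow_iff hp, ← hSp]
    exact ENNReal.le_tsum j
  rw [one_div, ENNReal.rpow_inv_le_iff hq]
  calc ∑ j ∈ s, a j ^ q ≤ ∑ j ∈ s, a j ^ p * S ^ (q - p) := by
        refine Finset.sum_le_sum fun j _ => ?_
        rw [show a j ^ q = a j ^ p * a j ^ (q - p) by
          rw [← ENNReal.rpow_add_of_nonneg _ _ hp.le (by linarith)]; ring_nf]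
        gcongr
        exact ha j
    _ ≤ S ^ p * S ^ (q - p) := by
        rw [← Finset.sum_mul, ← hSp]
        gcongr
        exact ENNReal.sum_le_tsum s
    _ = S ^ q := by
        rw [← ENNReal.rpow_add_of_nonneg _ _ hp.le (by linarith)]; ring_nf

section Schrodinger

open FourierTransform

theorem continuous_schrodinger {n : ℕ} (f : Rn n → ℂ) :
    Continuous fun z : ℝ × Rn n => schrodinger f z.1 z.2 := by
  by_cases hf : Integrable f ∧ Integrable (𝓕 f)
  · simp_rw [schrodinger_eq_freeWave]
    exact continuous_freeWave hf.2
  · simp_rw [schrodinger_eq_zero hf]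
    exact continuous_const

theorem measurable_schrodinger_comp {n : ℕ} (f : Rn n → ℂ) {x : ℝ → Rn n} (hx : Measurable x) :
    Measurable fun t => schrodinger f t (x t) :=
  Measurable.comp (g := fun z : ℝ × Rn n => schrodinger f z.1 z.2) (f := fun t => (t, x t))
    (continuous_schrodinger f).measurable (measurable_id.prodMk hx)

theorem exists_norm_schrodinger_le {n : ℕ} (f : Rn n → ℂ) :
    ∃ B : ℝ, ∀ t x, ‖schrodinger f t x‖ ≤ B := by
  by_cases hf : Integrable f ∧ Integrable (𝓕 f)
  · exact ⟨_, fun t x => by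
      rw [schrodinger_eq_freeWave]; exact norm_freeWave_le hf.2 t x⟩
  · exact ⟨0, fun t x => by simp [schrodinger_eq_zero hf]⟩

/-- The estimate along a measurable curve, in dual form. -/
theorem exists_schrodinger_bound :
    ∃ C : ℝ≥0∞, C ≠ ∞ ∧ ∀ {f : ℕ → Rn 1 → ℂ}, OrthonormalL2 f → ∀ {x : ℝ → Rn 1} {w : ℝ → ℝ},
      Measurable x → Measurable w → Integrable (fun t => w t ^ 2) →
      ∀ (a : ℕ → ℝ≥0∞) (s : Finset ℕ),
      ∫⁻ t, ‖w t‖ₑ ^ 2 * ∑ j ∈ s, a j * ‖schrodinger (f j) t (x t)‖ₑ ^ 2 ≤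
        C * (∑ j ∈ s, a j ^ (4 / 3 : ℝ)) ^ (3 / 4 : ℝ) *
          (∫⁻ t, (‖w t‖ₑ ^ 2) ^ 2) ^ (1 / 2 : ℝ) := by
  classical
  obtain ⟨C, hC, hb⟩ := exists_freeWave_bound (V := Rn 1) (by simp)
  refine ⟨C ^ (1 / 4 : ℝ), rpow_ne_top_of_nonneg (by norm_num) hC, ?_⟩
  intro f hf x w hx hw hwi a s
  set J : ℕ → Prop := fun j => Integrable (f j) ∧ Integrable (𝓕 (f j)) with hJ
  set D : ℕ → ℝ≥0∞ := fun j => ∫⁻ t, ‖w t‖ₑ ^ 2 * ‖schrodinger (f j) t (x t)‖ₑ ^ 2 with hD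
  have hD0 : ∀ j, ¬ J j → D j = 0 := fun j hj => by simp [hD, schrodinger_eq_zero hj]
  have hsum : ∑ j ∈ s, D j ^ 4 ≤ C * (∫⁻ t, (‖w t‖ₑ ^ 2) ^ 2) ^ 2 := by
    have h1 := hb hx hw hwi (φ := fun j : Subtype J => 𝓕 (f j)) (fun j => j.2.2)
      (fun j => memLp_two_fourier j.2.2)
      (orthonormal_toLp_fourier hf Subtype.val_injective (fun j => j.2.1) fun j => j.2.2)
      (s.subtype J)
    simp_rw [← schrodinger_eq_freeWave] at h1
    rwa [Finset.sum_subtype_eq_sum_filter (f := fun j => D j ^ 4), Finset.sum_filter_of_ne] at h1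
    intro j _ hj
    by_contra h
    simp [hD0 j h] at hj
  refine le_trans (le_of_eq ?_) (ENNReal.sum_mul_le_of_sum_pow_four_le s a D hsum)
  simp_rw [Finset.mul_sum]
  have hm : ∀ j, Measurable fun t => ‖w t‖ₑ ^ 2 * ‖schrodinger (f j) t (x t)‖ₑ ^ 2 := fun j =>
    (hw.enorm.pow_const 2).mul ((measurable_schrodinger_comp (f j) hx).enorm.pow_const 2)
  rw [lintegral_finsetSum]
  · refine Finset.sum_congr rfl fun j _ => ?_
    rw [hD, ← lintegral_const_mul _ (hm j)]
    congr 1 with t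
    ring
  · intro j _
    simp_rw [mul_left_comm]
    exact (hm j).const_mul _

end Schrodinger

/-- The partial sums of the density `Σ_j a_j |e^{it∂ₓ²}f_j|²`, with values in `ℝ≥0∞`. -/
def partialDensity {n : ℕ} (a : ℕ → ℝ≥0∞) (f : ℕ → Rn n → ℂ) (N : ℕ) (t : ℝ) (x : Rn n) : ℝ≥0∞ :=
  ∑ j ∈ Finset.range N, a j * ‖schrodinger (f j) t x‖ₑ ^ 2

section PartialDensity

variable {n : ℕ} {a : ℕ → ℝ≥0∞} {f : ℕ → Rn n → ℂ}

theorem partialDensity_mono {M N : ℕ} (h : M ≤ N) (t : ℝ) (x : Rn n) :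
    partialDensity a f M t x ≤ partialDensity a f N t x :=
  Finset.sum_le_sum_of_subset (Finset.range_mono h)

theorem measurable_partialDensity_comp (N : ℕ) {x : ℝ → Rn n} (hx : Measurable x) :
    Measurable fun t => partialDensity a f N t (x t) :=
  Finset.measurable_sum _ fun j _ =>
    ((measurable_schrodinger_comp (f j) hx).enorm.pow_const 2).const_mul _

theorem continuous_partialDensity (ha : ∀ j, a j ≠ ∞) (N : ℕ) (t : ℝ) :
    Continuous (partialDensity a f N t) := by
  have h : ∀ j, Continuous (schrodinger (f j) t) := fun j =>
    Continuous.comp (g := fun z : ℝ × Rn n => schrodinger (f j) z.1 z.2) (f := fun x => (t, x))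
      (continuous_schrodinger (f j)) (by fun_prop)
  exact continuous_finsetSum _ fun j _ =>
    ENNReal.continuous_const_mul (ha j) |>.comp ((ENNReal.continuous_pow 2).comp (h j).enorm)

theorem exists_partialDensity_le (ha : ∀ j, a j ≠ ∞) (N : ℕ) :
    ∃ B : ℝ≥0∞, B ≠ ∞ ∧ ∀ t x, partialDensity a f N t x ≤ B := by
  choose B hB using fun j => exists_norm_schrodinger_le (f j)
  refine ⟨∑ j ∈ Finset.range N, a j * ENNReal.ofReal (B j) ^ 2,
    (ENNReal.sum_lt_top.2 fun j _ => mul_lt_top (ha j).lt_top (pow_lt_top ofReal_lt_top)).ne,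
    fun t x => Finset.sum_le_sum fun j _ => ?_⟩
  gcongr
  rw [← ofReal_norm]
  exact ofReal_le_ofReal (hB j t x)

theorem enorm_density_le_iSup_partialDensity (lam : ℕ → ℝ) (t : ℝ) (x : Rn n) :
    ‖density lam f t x‖ₑ ≤ ⨆ N, partialDensity (fun j => ENNReal.ofReal |lam j|) f N t x := by
  refine enorm_tsum_le_tsum_enorm.trans (le_of_eq ?_)
  rw [ENNReal.tsum_eq_iSup_nat]
  simp only [partialDensity, enorm_mul, enorm_pow, enorm_norm, Real.enorm_eq_ofReal_abs (lam _)]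

/-- A bound for the partial densities along all measurable curves, in dual form, implies the mixed
norm bound for the density. -/
theorem mixedLp_density_le {lam : ℕ → ℝ} {K : ℝ≥0∞}
    (hK : ∀ (N : ℕ) (x : ℝ → Rn n) (w : ℝ → ℝ), Measurable x → Measurable w →
      Integrable (fun t => w t ^ 2) →
      ∫⁻ t, ‖w t‖ₑ ^ 2 * partialDensity (fun j => ENNReal.ofReal |lam j|) f N t (x t) ≤
        K * (∫⁻ t, (‖w t‖ₑ ^ 2) ^ 2) ^ (1 / 2 : ℝ)) :
    mixedLp 2 ∞ (density lam f) ≤ K := by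
  set F := partialDensity (fun j => ENNReal.ofReal |lam j|) f with hF
  set q := TopologicalSpace.denseSeq (Rn n) with hq
  set S : ℕ → Set ℝ := fun N => Icc (-N) N with hS
  set G : ℕ → ℝ → ℝ≥0∞ := fun N => (S N).indicator fun t => (⨆ i ≤ N, F N t (q i)) ^ 2 with hG
  have hFm : ∀ N (x : ℝ → Rn n), Measurable x → Measurable fun t => F N t (x t) := fun N _ hx =>
    measurable_partialDensity_comp N hx
  have hSm : ∀ N, MeasurableSet (S N) := fun N => measurableSet_Icc
  have hGm : ∀ N, Measurable (G N) := fun N =>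
    ((Measurable.iSup fun i => Measurable.iSup fun _ =>
      hFm N (fun _ => q i) measurable_const).pow_const 2).indicator (hSm N)
  have hGmono : Monotone G := by
    intro M N hMN t
    have hMN' : (M : ℝ) ≤ N := by exact_mod_cast hMN
    refine (indicator_le_indicator_of_subset (Icc_subset_Icc (neg_le_neg hMN') hMN')
      (fun _ => zero_le) t).trans (indicator_le_indicator
      (pow_le_pow_left' (iSup₂_le fun i hi => ?_) 2))
    exact le_iSup₂_of_le i (hi.trans hMN) (partialDensity_mono hMN t _)
  have hGint : ∀ N, ∫⁻ t, G N t ≤ K ^ 2 := fun N => by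
    obtain ⟨B, hB, hFB⟩ := exists_partialDensity_le (a := fun j => ENNReal.ofReal |lam j|) (f := f)
      (fun j => ofReal_ne_top) N
    rw [lintegral_indicator (hSm N)]
    exact setLIntegral_iSup_sq_le hB hFB (hFm N) (hK N) q N (hSm N) measure_Icc_lt_top.ne
  have hpt : ∀ t, eLpNorm (density lam f t) ∞ volume ^ 2 ≤ ⨆ N, G N t := fun t => by
    obtain ⟨T, hT⟩ := exists_nat_ge |t|
    set c := ⨆ N, ⨆ i, F N t (q i) with hc
    have h1 : eLpNorm (density lam f t) ∞ volume ≤ c := by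
      rw [eLpNorm_exponent_top]
      refine eLpNormEssSup_le_of_ae_enorm_bound (ae_of_all _ fun x =>
        (enorm_density_le_iSup_partialDensity lam t x).trans (iSup_mono fun N => ?_))
      have hcl : IsClosed {y | F N t y ≤ ⨆ i, F N t (q i)} :=
        isClosed_le (continuous_partialDensity (fun j => ofReal_ne_top) N t) continuous_const
      refine hcl.closure_subset_iff.2 ?_ ((TopologicalSpace.denseRange_denseSeq (Rn n)) x)
      rintro _ ⟨i, rfl⟩
      exact le_iSup (fun i => F N t (q i)) i
    refine (pow_le_pow_left' h1 2).trans ?_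
    simp_rw [hc, ENNReal.iSup_pow]
    refine iSup_le fun N => iSup_le fun i => le_iSup_of_le (max T (max N i)) ?_
    have hmem : t ∈ S (max T (max N i)) := by
      have : |t| ≤ (max T (max N i) : ℕ) := hT.trans (by exact_mod_cast le_max_left _ _)
      exact abs_le.1 this
    simp only [hG, indicator_of_mem hmem]
    refine pow_le_pow_left' ?_ 2
    exact le_iSup₂_of_le i ((le_max_right _ _).trans (le_max_right _ _))
      (partialDensity_mono ((le_max_left _ _).trans (le_max_right _ _)) t _)
  have hint : ∫⁻ t, eLpNorm (density lam f t) ∞ volume ^ 2 ≤ K ^ 2 := by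
    refine (lintegral_mono hpt).trans ?_
    rw [lintegral_iSup hGm hGmono]
    exact iSup_le hGint
  rw [mixedLp, eLp, if_neg (by simp), one_div, ENNReal.rpow_inv_le_iff (by simp)]
  simpa using hint

end PartialDensity

/-- For `n = 1` and `1 ≤ α ≤ 4/3`, the strong-type estimate
`‖Σ λ_j |e^{it∂ₓ²}f_j|²‖_{L^2(ℝ, L^∞(ℝ))} ≲ ‖λ‖_{ℓ^α}` holds over systems
orthonormal in `L²(ℝ)`. -/
theorem strong_type_one_dim (α : ℝ) (hα1 : 1 ≤ α) (hα2 : α ≤ 4 / 3) :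
    ∃ C : ℝ, 0 < C ∧ ∀ (f : ℕ → Rn 1 → ℂ) (lam : ℕ → ℝ),
      OrthonormalL2 f → seqNormE (ENNReal.ofReal α) lam ≠ ∞ →
      mixedLp 2 ∞ (density lam f)
        ≤ ENNReal.ofReal C * seqNormE (ENNReal.ofReal α) lam := by
  obtain ⟨C, hC, hb⟩ := exists_schrodinger_bound
  refine ⟨C.toReal + 1, by positivity, fun f lam hf _ => ?_⟩
  have hα : 0 < α := by linarith
  refine mixedLp_density_le fun N x w hx hw hwi =>
    (hb hf hx hw hwi (fun j => ENNReal.ofReal |lam j|) (Finset.range N)).trans ?_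
  gcongr
  · rw [ENNReal.ofReal_add toReal_nonneg zero_le_one, ofReal_toReal hC]
    exact le_self_add
  · rw [seqNormE, if_neg ofReal_ne_top, toReal_ofReal hα.le,
      show (3 / 4 : ℝ) = 1 / (4 / 3) by norm_num]
    exact ENNReal.rpow_sum_rpow_le_of_exponent_le _ _ hα hα2
end
end

section
/- Let n ≥ 1, 1 < p < ∞ and let s be given by 2s = n − n/p. Then there is a constant C such that ‖ Σ_j λ_j |e^{itΔ}f_j|² ‖_{L^∞(ℝ, L^{p,∞}(ℝⁿ))} ≤ C ‖{λ_j}‖_{ℓ^{p,1}} for all families {f_j} of functions orthonormal in Ḣ^s(ℝⁿ) and all sequences {λ_j} ∈ ℓ^{p,1}. -/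
noncomputable section

open MeasureTheory ENNReal Real Set

open OS

open FourierTransform

/-- Plancherel's theorem for functions in `L¹ ∩ L²`. -/
theorem eLpNorm_fourier_eq {E : Type*} [NormedAddCommGroup E] [InnerProductSpace ℝ E]
    [FiniteDimensional ℝ E] [MeasurableSpace E] [BorelSpace E] {G : E → ℂ}
    (h1 : Integrable G) (h2 : MemLp G 2) :
    eLpNorm (𝓕 G) 2 = eLpNorm G 2 := by
  have hcont : Continuous (𝓕 G) :=
    VectorFourier.fourierIntegral_continuous Real.continuous_fourierChar continuous_inner h1
  have key : ∀ᵐ x, (𝓕 (h2.toLp G) : Lp ℂ 2 (volume : Measure E)) x = 𝓕 G x := by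
    refine ae_eq_of_integral_contDiff_smul_eq ((Lp.memLp _).locallyIntegrable (by norm_num))
      hcont.locallyIntegrable fun g hg hgs => ?_
    have hc : ContDiff ℝ ((⊤ : ℕ∞) : WithTop ℕ∞) (Complex.ofRealCLM ∘ g) :=
      Complex.ofRealCLM.contDiff.comp hg
    have hs : HasCompactSupport (Complex.ofRealCLM ∘ g) := hgs.comp_left (by simp)
    obtain ⟨φ, hφg⟩ : ∃ φ : SchwartzMap E ℂ, ∀ x, φ x = g x :=
      ⟨hs.toSchwartzMap hc, fun x => by simp⟩
    have e := congrArg (fun T => T φ) (Lp.fourier_toTemperedDistribution_eq (h2.toLp G))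
    simp only [TemperedDistribution.fourier_apply, Lp.toTemperedDistribution_apply] at e
    calc _ = ∫ x, φ x • (𝓕 (h2.toLp G) : Lp ℂ 2 (volume : Measure E)) x := by simp [hφg]
      _ = ∫ x, (𝓕 φ) x • (h2.toLp G) x := e.symm
      _ = ∫ x, (𝓕 φ) x • G x := by
        refine integral_congr_ae ?_
        filter_upwards [h2.coeFn_toLp] with x hx
        rw [hx]
      _ = ∫ x, φ x • 𝓕 G x := by
        simpa [SchwartzMap.fourier_coe] using! VectorFourier.integral_fourierIntegral_smul_eq_flip
          (L := innerₗ E) Real.continuous_fourierChar continuous_inner φ.integrable h1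
      _ = _ := by simp [hφg]
  have hn := Lp.norm_fourier_eq (h2.toLp G)
  generalize (𝓕 (h2.toLp G) : Lp ℂ 2 (volume : Measure E)) = u at key hn
  rw [← eLpNorm_congr_ae key, ← eLpNorm_congr_ae h2.coeFn_toLp, ← Lp.enorm_def, ← Lp.enorm_def,
    ← ofReal_norm, ← ofReal_norm, hn]

/-- The unnormalized inverse Fourier integral `x ↦ ∫ e^{i x·ξ} G(ξ) dξ`. -/
def expInt {n : ℕ} (G : Rn n → ℂ) (x : Rn n) : ℂ :=
  ∫ ξ : Rn n, Complex.exp (Complex.I * dotC x ξ) * G ξ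

theorem norm_exp_I_mul_dotC {n : ℕ} (x ξ : Rn n) :
    ‖Complex.exp (Complex.I * dotC x ξ)‖ = 1 := by
  rw [dotC, mul_comm, Complex.norm_exp_ofReal_mul_I]

theorem continuous_exp_I_mul_dotC {n : ℕ} (x : Rn n) :
    Continuous fun ξ : Rn n => Complex.exp (Complex.I * dotC x ξ) := by
  unfold dotC
  fun_prop

theorem integrable_exp_mul_iff {n : ℕ} (x : Rn n) {G : Rn n → ℂ} :
    Integrable (fun ξ => Complex.exp (Complex.I * dotC x ξ) * G ξ) ↔ Integrable G := by
  have h : ∀ (y : Rn n) {H : Rn n → ℂ}, Integrable H →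
      Integrable fun ξ => Complex.exp (Complex.I * dotC y ξ) * H ξ := fun y H hH =>
    hH.bdd_mul (c := 1) (continuous_exp_I_mul_dotC y).aestronglyMeasurable
      (ae_of_all _ fun ξ => (norm_exp_I_mul_dotC y ξ).le)
  refine ⟨fun hG => ?_, h x⟩
  refine (h (-x) hG).congr (ae_of_all _ fun ξ => ?_)
  have : dotC (-x) ξ = -dotC x ξ := by simp [dotC]
  simp only [this]
  rw [← mul_assoc, ← Complex.exp_add]
  simp

theorem expInt_eq_fourier {n : ℕ} (G : Rn n → ℂ) (x : Rn n) :
    expInt G x = 𝓕 G ((-(2 * π)⁻¹ : ℝ) • x) := by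
  rw [Real.fourier_eq', expInt]
  congr 1 with ξ
  rw [smul_eq_mul, real_inner_smul_right]
  congr 2
  rw [mul_comm, dotC]
  congr 2
  rw [show -2 * π * (-(2 * π)⁻¹ * inner ℝ ξ x) = inner ℝ ξ x by field_simp]
  simp [PiLp.inner_apply]

theorem continuous_expInt {n : ℕ} (G : Rn n → ℂ) : Continuous (expInt G) := by
  by_cases hG : Integrable G
  · have h : Continuous (𝓕 G) :=
      VectorFourier.fourierIntegral_continuous Real.continuous_fourierChar continuous_inner hG
    rw [show expInt G = fun x => 𝓕 G ((-(2 * π)⁻¹ : ℝ) • x) from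
      funext fun x => expInt_eq_fourier G x]
    exact h.comp (continuous_const_smul _)
  · have : expInt G = fun _ => 0 := funext fun x =>
      integral_undef fun h => hG ((integrable_exp_mul_iff x).1 h)
    rw [this]
    exact continuous_const

theorem FT_eq_expInt {n : ℕ} (f : Rn n → ℂ) (ξ : Rn n) : FT f ξ = expInt f (-ξ) := by
  unfold FT expInt
  congr 1 with x
  congr 2
  simp [dotC, mul_comm]

theorem continuous_FT {n : ℕ} (f : Rn n → ℂ) : Continuous (FT f) := by
  rw [show FT f = fun ξ => expInt f (-ξ) from funext fun ξ => FT_eq_expInt f ξ]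
  exact (continuous_expInt f).comp continuous_neg

theorem lintegral_expInt_sq {n : ℕ} {G : Rn n → ℂ} (h1 : Integrable G) (h2 : MemLp G 2) :
    ∫⁻ x, ‖expInt G x‖ₑ ^ 2 = ENNReal.ofReal ((2 * π) ^ n) * eLpNorm G 2 ^ 2 := by
  have hc : Continuous (𝓕 G) :=
    VectorFourier.fourierIntegral_continuous Real.continuous_fourierChar continuous_inner h1
  have hm : Measurable fun x => ‖𝓕 G x‖ₑ ^ 2 := hc.measurable.enorm.pow_const 2
  have ha : (-(2 * π)⁻¹ : ℝ) ≠ 0 := by simp [Real.pi_ne_zero]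
  have hsq : eLpNorm G 2 ^ 2 = ∫⁻ x, ‖𝓕 G x‖ₑ ^ 2 := by
    rw [← eLpNorm_fourier_eq h1 h2, eLpNorm_eq_lintegral_rpow_enorm_toReal (by simp) (by simp),
      ← ENNReal.rpow_natCast, ← ENNReal.rpow_mul]
    simp
  calc ∫⁻ x, ‖expInt G x‖ₑ ^ 2
      = ∫⁻ x, (fun y => ‖𝓕 G y‖ₑ ^ 2) ((-(2 * π)⁻¹ : ℝ) • x) := by simp [expInt_eq_fourier]
    _ = ∫⁻ y, ‖𝓕 G y‖ₑ ^ 2 ∂(Measure.map ((-(2 * π)⁻¹ : ℝ) • ·) volume) :=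
        (lintegral_map hm (measurable_const_smul _)).symm
    _ = _ := by
      rw [Measure.map_addHaar_smul _ ha, lintegral_smul_measure, hsq, smul_eq_mul]
      congr 2
      simp only [abs_inv, abs_pow, abs_neg, finrank_euclideanSpace, Fintype.card_fin]
      rw [← inv_pow, inv_inv, abs_of_pos Real.two_pi_pos]

theorem natCast_rpow_le_sum {θ : ℝ} (h0 : 0 < θ) (h1 : θ ≤ 1) (m : ℕ) :
    (m : ℝ≥0∞) ^ θ ≤ ∑ k ∈ Finset.range m, ((k : ℝ≥0∞) + 1) ^ θ * ((k : ℝ≥0∞) + 1)⁻¹ := by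
  induction m with
  | zero => simp [h0]
  | succ m ih =>
    rw [Finset.sum_range_succ]
    refine le_trans ?_ (add_le_add_left ih _)
    have hr : ((m : ℝ) + 1) ^ θ ≤ (m : ℝ) ^ θ + ((m : ℝ) + 1) ^ θ * ((m : ℝ) + 1)⁻¹ := by
      rcases Nat.eq_zero_or_pos m with rfl | hm
      · simp [h0.ne']
      have hm' : (0 : ℝ) < m := by exact_mod_cast hm
      have hp : (0 : ℝ) < (m : ℝ) + 1 := by positivity
      have key : ((m : ℝ) + 1) ^ (θ - 1) ≤ (m : ℝ) ^ (θ - 1) :=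
        Real.rpow_le_rpow_of_nonpos hm' (by linarith) (by linarith)
      rw [Real.rpow_sub_one hp.ne', Real.rpow_sub_one hm'.ne', div_le_div_iff₀ hp hm'] at key
      field_simp
      linarith
    have := ENNReal.ofReal_le_ofReal hr
    rw [ENNReal.ofReal_add (by positivity) (by positivity), ENNReal.ofReal_mul (by positivity),
      ENNReal.ofReal_inv_of_pos (by positivity), ← ENNReal.ofReal_rpow_of_nonneg (by positivity) h0.le,
      ← ENNReal.ofReal_rpow_of_nonneg (by positivity) h0.le,
      ENNReal.ofReal_add (by positivity) (by positivity)] at this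
    simpa using this

theorem le_seqRearr_of_lt_count {lam : ℕ → ℝ} {k : ℕ} {s : ℝ≥0∞}
    (h : (k : ℝ≥0∞) < Measure.count {i : ℕ | s < ENNReal.ofReal |lam i|}) :
    s ≤ seqRearr lam k := by
  refine le_sInf fun s' hs' => ?_
  by_contra! hlt
  exact absurd (h.trans_le (measure_mono fun i (hi : s < _) => hlt.trans hi)) (not_lt.2 hs')

theorem volume_Ioi_inter_ofReal_le (r : ℝ≥0∞) :
    volume (Ioi (0 : ℝ) ∩ {s | ENNReal.ofReal s ≤ r}) ≤ r := by
  rcases eq_or_ne r ∞ with rfl | hr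
  · exact le_top
  calc _ ≤ volume (Ioc 0 r.toReal) := measure_mono fun s hs =>
        ⟨hs.1, (ENNReal.ofReal_le_iff_le_toReal hr).1 hs.2⟩
    _ = r := by simp [hr]

/-- A sequence whose sums over `N` indices are at most `K N^θ` pairs with `ℓ^{1/θ,1}`. -/
theorem tsum_mul_le_seqLor {θ : ℝ} (h0 : 0 < θ) (h1 : θ ≤ 1) (lam : ℕ → ℝ) (a : ℕ → ℝ≥0∞)
    (K : ℝ≥0∞) (hK : ∀ J : Finset ℕ, ∑ j ∈ J, a j ≤ K * (J.card : ℝ≥0∞) ^ θ) :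
    ∑' j, ENNReal.ofReal |lam j| * a j ≤ K * seqLor θ 1 lam := by
  set w : ℕ → ℝ≥0∞ := fun k => ((k : ℝ≥0∞) + 1) ^ θ * ((k : ℝ≥0∞) + 1)⁻¹ with hw
  have hlayer : ∀ j, ENNReal.ofReal |lam j| * a j =
      ∫⁻ s in Ioi (0 : ℝ), (Iio |lam j|).indicator (fun _ => a j) s := fun j => by
    rw [lintegral_indicator measurableSet_Iio, setLIntegral_const,
      Measure.restrict_apply measurableSet_Iio, Iio_inter_Ioi, Real.volume_Ioo, sub_zero, mul_comm]
  have hpt : ∀ s ∈ Ioi (0 : ℝ), ∑' j, (Iio |lam j|).indicator (fun _ => a j) s ≤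
      ∑' k, K * {s : ℝ | ENNReal.ofReal s ≤ seqRearr lam k}.indicator (fun _ => w k) s := by
    intro s hs
    rw [ENNReal.tsum_mul_left]
    refine ENNReal.summable.tsum_le_of_sum_le fun J => ?_
    set J' := J.filter fun j => s < |lam j| with hJ'
    calc ∑ j ∈ J, (Iio |lam j|).indicator (fun _ => a j) s = ∑ j ∈ J', a j := by
          simp [hJ', Finset.sum_filter, indicator_apply]
      _ ≤ K * (J'.card : ℝ≥0∞) ^ θ := hK J'
      _ ≤ K * ∑ k ∈ Finset.range J'.card, w k := by
          gcongr
          exact natCast_rpow_le_sum h0 h1 _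
      _ = K * ∑ k ∈ Finset.range J'.card,
            {s : ℝ | ENNReal.ofReal s ≤ seqRearr lam k}.indicator (fun _ => w k) s := by
          congr 1
          refine Finset.sum_congr rfl fun k hk => ?_
          have hmem : s ∈ {s : ℝ | ENNReal.ofReal s ≤ seqRearr lam k} := by
            refine le_seqRearr_of_lt_count ?_
            calc (k : ℝ≥0∞) < J'.card := by exact_mod_cast Finset.mem_range.1 hk
              _ = Measure.count (J' : Set ℕ) := (Measure.count_apply_finset J').symm
              _ ≤ _ := measure_mono fun i hi => by
                have hi' : s < |lam i| := (Finset.mem_filter.1 (Finset.mem_coe.1 hi)).2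
                exact (ENNReal.ofReal_lt_ofReal_iff ((mem_Ioi.1 hs).trans hi')).2 hi'
          exact (indicator_of_mem hmem fun _ => w k).symm
      _ ≤ _ := by
          gcongr
          exact ENNReal.sum_le_tsum _
  have hms : ∀ k, MeasurableSet {s : ℝ | ENNReal.ofReal s ≤ seqRearr lam k} := fun k =>
    measurableSet_le ENNReal.measurable_ofReal measurable_const
  calc ∑' j, ENNReal.ofReal |lam j| * a j
      = ∫⁻ s in Ioi (0 : ℝ), ∑' j, (Iio |lam j|).indicator (fun _ => a j) s := by
        rw [lintegral_tsum fun j => (measurable_const.indicator measurableSet_Iio).aemeasurable]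
        exact tsum_congr hlayer
    _ ≤ ∫⁻ s in Ioi (0 : ℝ),
          ∑' k, K * {s : ℝ | ENNReal.ofReal s ≤ seqRearr lam k}.indicator (fun _ => w k) s :=
        setLIntegral_mono' measurableSet_Ioi hpt
    _ = ∑' k, K * (w k * volume (Ioi (0 : ℝ) ∩ {s : ℝ | ENNReal.ofReal s ≤ seqRearr lam k})) := by
        rw [lintegral_tsum fun k =>
          ((measurable_const.indicator (hms k)).const_mul K).aemeasurable]
        refine tsum_congr fun k => ?_
        rw [lintegral_const_mul _ (measurable_const.indicator (hms k)),
          lintegral_indicator (hms k), setLIntegral_const, Measure.restrict_apply (hms k), inter_comm]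
    _ ≤ ∑' k, K * (w k * seqRearr lam k) := by
        gcongr
        exact volume_Ioi_inter_ofReal_le _
    _ = K * seqLor θ 1 lam := by
        rw [ENNReal.tsum_mul_left, seqLor]
        simp only [ENNReal.rpow_one, div_one, hw]
        congr 2 with k
        ring

theorem integral_ball_norm_rpow {n : ℕ} (hn : 1 ≤ n) {s : ℝ} (hs : 2 * s < n) :
    ∃ A : ℝ, 0 ≤ A ∧ ∀ R : ℝ, 0 < R →
      IntegrableOn (fun ξ : Rn n => ‖ξ‖ ^ (-(2 * s))) (Metric.ball 0 R) ∧
      ∫ ξ in Metric.ball (0 : Rn n) R, ‖ξ‖ ^ (-(2 * s)) = A * R ^ (n - 2 * s) := by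
  have : Nonempty (Fin n) := ⟨⟨0, hn⟩⟩
  have hpos : 0 < n - 2 * s := by linarith
  refine ⟨n * ((volume : Measure (Rn n)).real (Metric.ball 0 1) * (n - 2 * s)⁻¹),
    by positivity, fun R hR => ⟨?_, ?_⟩⟩
  · refine integrableOn_ball_of_norm_le_rpow (by simpa using hn) (C := 1) (α := 2 * s)
      (by simpa using hs) ?_
      (Measurable.aestronglyMeasurable (by fun_prop))
    exact ae_of_all _ fun ξ => by
      simp [abs_of_nonneg (Real.rpow_nonneg (norm_nonneg ξ) _)]
  · have h := integral_fun_norm_addHaar (volume : Measure (Rn n))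
      ((Iio R).indicator fun y : ℝ => y ^ (-(2 * s)))
    have e1 : (fun ξ : Rn n => (Iio R).indicator (fun y : ℝ => y ^ (-(2 * s))) ‖ξ‖) =
        (Metric.ball (0 : Rn n) R).indicator fun ξ => ‖ξ‖ ^ (-(2 * s)) := by
      ext ξ
      by_cases hξ : ‖ξ‖ < R
      · rw [indicator_of_mem (mem_Iio.2 hξ), indicator_of_mem (mem_ball_zero_iff.2 hξ)]
      · rw [indicator_of_notMem (by simpa using hξ), indicator_of_notMem (by simpa using hξ)]
    have e2 : ∫ y in Ioi (0 : ℝ), y ^ (n - 1) • (Iio R).indicator (fun y : ℝ => y ^ (-(2 * s))) y =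
        (n - 2 * s)⁻¹ * R ^ (n - 2 * s) := by
      have e3 : ∀ y ∈ Ioi (0 : ℝ), y ^ (n - 1) • (Iio R).indicator (fun y : ℝ => y ^ (-(2 * s))) y =
          (Iio R).indicator (fun y : ℝ => y ^ (n - 1 - 2 * s)) y := by
        intro y hy
        by_cases hyR : y < R
        · simp only [mem_Iio, hyR, indicator_of_mem, smul_eq_mul]
          rw [← Real.rpow_natCast, ← Real.rpow_add hy, Nat.cast_sub hn]
          congr 1
          push_cast
          ring
        · simp [hyR]
      rw [setIntegral_congr_fun measurableSet_Ioi e3, setIntegral_indicator measurableSet_Iio,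
        Ioi_inter_Iio, ← integral_Ioc_eq_integral_Ioo, ← intervalIntegral.integral_of_le hR.le,
        integral_rpow (Or.inl (by linarith))]
      rw [show (n : ℝ) - 1 - 2 * s + 1 = n - 2 * s by ring, Real.zero_rpow hpos.ne']
      field_simp
      ring
    rw [e1, integral_indicator measurableSet_ball, finrank_euclideanSpace, Fintype.card_fin,
      e2] at h
    rw [h]
    simp only [nsmul_eq_mul, smul_eq_mul]
    ring

theorem lintegral_expInt_high {n : ℕ} {s c R : ℝ} (hs : 0 < s) (hc : 0 < c) (hR : 0 < R)
    {G : Rn n → ℂ} (hG : Integrable G)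
    (hφ : MemLp (fun ξ => ((√c * ‖ξ‖ ^ s : ℝ) : ℂ) * G ξ) 2)
    (hφ1 : eLpNorm (fun ξ => ((√c * ‖ξ‖ ^ s : ℝ) : ℂ) * G ξ) 2 = 1) :
    ∫⁻ x, ‖expInt ((Metric.ball 0 R)ᶜ.indicator G) x‖ₑ ^ 2 ≤
      ENNReal.ofReal ((2 * π) ^ n * (c⁻¹ * R ^ (-(2 * s)))) := by
  set H := (Metric.ball (0 : Rn n) R)ᶜ.indicator G with hH
  have hHi : Integrable H := hG.indicator measurableSet_ball.compl
  have hle : ∀ ξ, ‖H ξ‖ ≤ (√c * R ^ s)⁻¹ * ‖((√c * ‖ξ‖ ^ s : ℝ) : ℂ) * G ξ‖ := by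
    intro ξ
    have hRs : 0 < R ^ s := Real.rpow_pos_of_pos hR s
    have hcs : 0 < √c := Real.sqrt_pos.2 hc
    by_cases hξ : ξ ∈ (Metric.ball (0 : Rn n) R)ᶜ
    · have hRξ : R ≤ ‖ξ‖ := by simpa using hξ
      have : R ^ s ≤ ‖ξ‖ ^ s := Real.rpow_le_rpow hR.le hRξ hs.le
      rw [hH, indicator_of_mem hξ, norm_mul, Complex.norm_real, Real.norm_of_nonneg (by positivity),
        ← mul_assoc]
      refine le_mul_of_one_le_left (norm_nonneg _) ?_
      rw [inv_mul_eq_div, one_le_div (by positivity)]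
      gcongr
    · rw [hH, indicator_of_notMem hξ, norm_zero]
      positivity
  have hH2 : MemLp H 2 := hφ.of_le_mul hHi.aestronglyMeasurable (ae_of_all _ hle)
  have hn2 := eLpNorm_le_mul_eLpNorm_of_ae_le_mul (ae_of_all volume hle) 2
  rw [hφ1, mul_one] at hn2
  rw [lintegral_expInt_sq hHi hH2, ENNReal.ofReal_mul (by positivity)]
  gcongr
  calc eLpNorm H 2 volume ^ 2 ≤ ENNReal.ofReal (√c * R ^ s)⁻¹ ^ 2 := by gcongr
    _ = _ := by
      rw [← ENNReal.ofReal_pow (by positivity), inv_pow, mul_pow, Real.sq_sqrt hc.le,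
        mul_inv, Real.rpow_neg hR.le, mul_comm 2 s, Real.rpow_mul hR.le, Real.rpow_two]

theorem sum_expInt_low {n : ℕ} (hn : 1 ≤ n) {s c A R : ℝ} (hc : 0 < c)
    (hA : IntegrableOn (fun ξ : Rn n => ‖ξ‖ ^ (-(2 * s))) (Metric.ball 0 R) ∧
      ∫ ξ in Metric.ball (0 : Rn n) R, ‖ξ‖ ^ (-(2 * s)) = A * R ^ (n - 2 * s))
    {G : ℕ → Rn n → ℂ} (hφ : ∀ j, MemLp (fun ξ => ((√c * ‖ξ‖ ^ s : ℝ) : ℂ) * G j ξ) 2)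
    (ho : Orthonormal ℂ fun j => (hφ j).toLp _) (J : Finset ℕ) (x : Rn n) :
    ∑ j ∈ J, ‖expInt ((Metric.ball 0 R).indicator (G j)) x‖ ^ 2 ≤
      c⁻¹ * (A * R ^ (n - 2 * s)) := by
  have : Nonempty (Fin n) := ⟨⟨0, hn⟩⟩
  have hcs : 0 < √c := Real.sqrt_pos.2 hc
  set h : Rn n → ℂ := (Metric.ball 0 R).indicator fun ξ =>
    (((√c)⁻¹ * ‖ξ‖ ^ (-s) : ℝ) : ℂ) * starRingEnd ℂ (Complex.exp (Complex.I * dotC x ξ)) with hh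
  have hsq : (fun ξ => ‖h ξ‖ ^ 2) =
      (Metric.ball 0 R).indicator fun ξ => c⁻¹ * ‖ξ‖ ^ (-(2 * s)) := by
    ext ξ
    by_cases hξ : ξ ∈ Metric.ball (0 : Rn n) R
    · rw [hh, indicator_of_mem hξ, indicator_of_mem hξ, norm_mul, RCLike.norm_conj,
        norm_exp_I_mul_dotC, mul_one, Complex.norm_real, Real.norm_of_nonneg (by positivity),
        mul_pow, inv_pow, Real.sq_sqrt hc.le, ← Real.rpow_two, ← Real.rpow_mul (norm_nonneg _)]
      congr 2
      ring
    · rw [hh, indicator_of_notMem hξ, indicator_of_notMem hξ]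
      simp
  have hhm : AEStronglyMeasurable h := by
    refine AEStronglyMeasurable.indicator ?_ measurableSet_ball
    refine (Measurable.aestronglyMeasurable (by fun_prop)).mul ?_
    exact (RCLike.continuous_conj.comp (continuous_exp_I_mul_dotC x)).aestronglyMeasurable
  have hh2 : MemLp h 2 := by
    rw [memLp_two_iff_integrable_sq_norm hhm, hsq, integrable_indicator_iff measurableSet_ball]
    exact hA.1.const_mul _
  have hnorm : ‖hh2.toLp h‖ ^ 2 = c⁻¹ * (A * R ^ (n - 2 * s)) := by
    have e : ((‖hh2.toLp h‖ ^ 2 : ℝ) : ℂ) = ((∫ ξ, ‖h ξ‖ ^ 2 : ℝ) : ℂ) := by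
      have := inner_self_eq_norm_sq_to_K (𝕜 := ℂ) (hh2.toLp h)
      rw [L2.inner_def] at this
      rw [← integral_complex_ofReal]
      push_cast
      refine this.symm.trans (integral_congr_ae ?_)
      filter_upwards [hh2.coeFn_toLp] with ξ e1
      rw [e1, inner_self_eq_norm_sq_to_K]
      rfl
    rw [Complex.ofReal_inj.1 e, hsq, integral_indicator measurableSet_ball, integral_const_mul, hA.2]
  have hin : ∀ j, expInt ((Metric.ball 0 R).indicator (G j)) x =
      inner ℂ (hh2.toLp h) ((hφ j).toLp _) := by
    intro j
    rw [L2.inner_def, expInt]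
    refine integral_congr_ae ?_
    have h0 : ∀ᵐ ξ : Rn n, ξ ≠ 0 := by simp [ae_iff]
    filter_upwards [h0, hh2.coeFn_toLp, (hφ j).coeFn_toLp] with ξ hξ0 e1 e2
    rw [e1, e2, RCLike.inner_apply]
    by_cases hξ : ξ ∈ Metric.ball (0 : Rn n) R
    · have hp : 0 < ‖ξ‖ := norm_pos_iff.2 hξ0
      have hone : (√c * ‖ξ‖ ^ s) * ((√c)⁻¹ * ‖ξ‖ ^ (-s)) = 1 := by
        rw [Real.rpow_neg hp.le]
        have := Real.rpow_pos_of_pos hp s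
        field_simp
      rw [hh, indicator_of_mem hξ, indicator_of_mem hξ, map_mul, Complex.conj_conj,
        Complex.conj_ofReal]
      have hone' := congrArg (fun r : ℝ => (r : ℂ)) hone
      simp only [Complex.ofReal_mul, Complex.ofReal_one] at hone' ⊢
      linear_combination (-(Complex.exp (Complex.I * dotC x ξ) * G j ξ)) * hone'
    · rw [hh, indicator_of_notMem hξ, indicator_of_notMem hξ]
      simp
  rw [← hnorm]
  refine le_trans (le_of_eq ?_) (ho.sum_inner_products_le (s := J) (hh2.toLp h))
  refine Finset.sum_congr rfl fun j _ => ?_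
  rw [hin, norm_inner_symm]

theorem weighted_mul_conj {n : ℕ} {s c : ℝ} (hc : 0 < c) (G H : Rn n → ℂ) (ξ : Rn n) :
    (((√c * ‖ξ‖ ^ s : ℝ) : ℂ) * G ξ) * starRingEnd ℂ (((√c * ‖ξ‖ ^ s : ℝ) : ℂ) * H ξ) =
      c • (((‖ξ‖ ^ (2 * s) : ℝ) : ℂ) * (G ξ * starRingEnd ℂ (H ξ))) := by
  have h : (√c * ‖ξ‖ ^ s) * (√c * ‖ξ‖ ^ s) = c * ‖ξ‖ ^ (2 * s) := by
    rw [mul_comm 2 s, Real.rpow_mul (norm_nonneg _), Real.rpow_two, mul_mul_mul_comm,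
      Real.mul_self_sqrt hc.le, sq]
  have h' := congrArg (fun r : ℝ => (r : ℂ)) h
  simp only [Complex.ofReal_mul] at h'
  rw [map_mul, Complex.conj_ofReal, Complex.real_smul]
  simp only [Complex.ofReal_mul]
  linear_combination (G ξ * starRingEnd ℂ (H ξ)) * h'

theorem memLp_weighted {n : ℕ} {s c : ℝ} (hc : 0 < c) {G : Rn n → ℂ}
    (hG : AEStronglyMeasurable G)
    (h : c • ∫ ξ : Rn n, ((‖ξ‖ ^ (2 * s) : ℝ) : ℂ) * (G ξ * starRingEnd ℂ (G ξ)) = 1) :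
    MemLp (fun ξ => ((√c * ‖ξ‖ ^ s : ℝ) : ℂ) * G ξ) 2 := by
  have hm : AEStronglyMeasurable fun ξ => ((√c * ‖ξ‖ ^ s : ℝ) : ℂ) * G ξ :=
    (Measurable.aestronglyMeasurable (by fun_prop)).mul hG
  rw [memLp_two_iff_integrable_sq_norm hm]
  have hi : Integrable fun ξ : Rn n =>
      ((‖ξ‖ ^ (2 * s) : ℝ) : ℂ) * (G ξ * starRingEnd ℂ (G ξ)) := by
    by_contra hni
    rw [integral_undef hni] at h
    simp at h
  refine (hi.smul c).norm.congr (ae_of_all _ fun ξ => ?_)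
  simp only [Pi.smul_apply]
  rw [← weighted_mul_conj hc, norm_mul, RCLike.norm_conj, sq]

theorem orthonormal_weighted {n : ℕ} {s c : ℝ} (hc : 0 < c) {G : ℕ → Rn n → ℂ}
    (h : ∀ j k, c • ∫ ξ : Rn n, ((‖ξ‖ ^ (2 * s) : ℝ) : ℂ) * (G j ξ * starRingEnd ℂ (G k ξ)) =
      if j = k then 1 else 0)
    (hφ : ∀ j, MemLp (fun ξ => ((√c * ‖ξ‖ ^ s : ℝ) : ℂ) * G j ξ) 2) :
    Orthonormal ℂ fun j => (hφ j).toLp _ := by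
  rw [orthonormal_iff_ite]
  intro j k
  rw [L2.inner_def, show (if j = k then (1 : ℂ) else 0) = if k = j then 1 else 0 by
    simp only [eq_comm], ← h k j, ← integral_smul]
  refine integral_congr_ae ?_
  filter_upwards [(hφ j).coeFn_toLp, (hφ k).coeFn_toLp] with ξ e1 e2
  rw [e1, e2, RCLike.inner_apply, weighted_mul_conj hc]

/-- Splitting the frequencies at radius `R`: Bessel's inequality bounds the low frequencies
pointwise and Plancherel's theorem bounds the high frequencies on average. -/
theorem exists_sum_lintegral_expInt_le {n : ℕ} (hn : 1 ≤ n) {s c : ℝ} (hs : 0 < s)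
    (hsn : 2 * s < n) (hc : 0 < c) :
    ∃ B : ℝ, 0 < B ∧ ∀ (G : ℕ → Rn n → ℂ), (∀ j, AEStronglyMeasurable (G j)) →
      (∀ j k, c • ∫ ξ : Rn n, ((‖ξ‖ ^ (2 * s) : ℝ) : ℂ) * (G j ξ * starRingEnd ℂ (G k ξ)) =
        if j = k then 1 else 0) →
      ∀ (E : Set (Rn n)) (J : Finset ℕ) (R : ℝ), 0 < R →
        ∑ j ∈ J, ∫⁻ x in E, ‖expInt (G j) x‖ₑ ^ 2 ≤
          ENNReal.ofReal B * (ENNReal.ofReal (R ^ (n - 2 * s)) * volume E +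
            J.card * ENNReal.ofReal (R ^ (-(2 * s)))) := by
  obtain ⟨A, hA0, hA⟩ := integral_ball_norm_rpow hn hsn
  set D : ℝ := (2 * π) ^ n * c⁻¹ with hD
  have hD0 : 0 < D := by positivity
  refine ⟨2 * (c⁻¹ * A) + 2 * D, by positivity, fun G hGm horth E J R hR => ?_⟩
  have hφ : ∀ j, MemLp (fun ξ => ((√c * ‖ξ‖ ^ s : ℝ) : ℂ) * G j ξ) 2 := fun j =>
    memLp_weighted hc (hGm j) (by simpa using horth j j)
  have ho := orthonormal_weighted hc horth hφ
  set low : ℕ → Rn n → ℂ := fun j => expInt ((Metric.ball 0 R).indicator (G j)) with hlow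
  have hlowm : ∀ j, Measurable fun x => ‖low j x‖ₑ ^ 2 := fun j =>
    (continuous_expInt _).measurable.enorm.pow_const 2
  have hsingle : ∀ j, ∫⁻ x in E, ‖expInt (G j) x‖ₑ ^ 2 ≤
      2 * (∫⁻ x in E, ‖low j x‖ₑ ^ 2) + 2 * ENNReal.ofReal (D * R ^ (-(2 * s))) := by
    intro j
    by_cases hG : Integrable (G j)
    · set high : Rn n → ℂ := expInt ((Metric.ball 0 R)ᶜ.indicator (G j)) with hhigh
      have hsplit : ∀ x, expInt (G j) x = low j x + high x := fun x => by
        simp only [hlow, hhigh, expInt]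
        rw [← integral_add ((integrable_exp_mul_iff x).2 (hG.indicator measurableSet_ball))
          ((integrable_exp_mul_iff x).2 (hG.indicator measurableSet_ball.compl))]
        congr 1 with ξ
        rw [← mul_add, indicator_self_add_compl_apply]
      have hpt : ∀ x, ‖expInt (G j) x‖ₑ ^ 2 ≤ 2 * ‖low j x‖ₑ ^ 2 + 2 * ‖high x‖ₑ ^ 2 := fun x => by
        have h1 : ‖expInt (G j) x‖ ^ 2 ≤ 2 * ‖low j x‖ ^ 2 + 2 * ‖high x‖ ^ 2 := by
          rw [hsplit]
          nlinarith [norm_add_le (low j x) (high x), norm_nonneg (low j x + high x),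
            sq_nonneg (‖low j x‖ - ‖high x‖)]
        have h2 := ENNReal.ofReal_le_ofReal h1
        rw [ENNReal.ofReal_add (by positivity) (by positivity), ENNReal.ofReal_mul (by positivity),
          ENNReal.ofReal_mul (by positivity)] at h2
        simpa [ENNReal.ofReal_pow] using h2
      have hh := lintegral_expInt_high hs hc hR hG (hφ j) (by
        have h1 := ho.1 j
        rw [Lp.norm_toLp] at h1
        rw [← ENNReal.ofReal_toReal (hφ j).eLpNorm_ne_top, h1, ENNReal.ofReal_one])
      calc _ ≤ ∫⁻ x in E, (2 * ‖low j x‖ₑ ^ 2 + 2 * ‖high x‖ₑ ^ 2) := lintegral_mono hpt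
        _ = 2 * (∫⁻ x in E, ‖low j x‖ₑ ^ 2) + 2 * ∫⁻ x in E, ‖high x‖ₑ ^ 2 := by
          rw [lintegral_add_left ((hlowm j).const_mul 2), lintegral_const_mul _ (hlowm j),
            lintegral_const_mul' _ _ (by simp)]
        _ ≤ _ := by
          gcongr
          refine (setLIntegral_le_lintegral _ _).trans (hh.trans_eq ?_)
          rw [hD, mul_assoc]
    · have : ∀ x, expInt (G j) x = 0 := fun x =>
        integral_undef fun h => hG ((integrable_exp_mul_iff x).1 h)
      simp [this]
  have hlowsum : ∑ j ∈ J, ∫⁻ x in E, ‖low j x‖ₑ ^ 2 ≤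
      ENNReal.ofReal (c⁻¹ * A) * (ENNReal.ofReal (R ^ (n - 2 * s)) * volume E) := by
    rw [← lintegral_finsetSum _ fun j _ => hlowm j, ← mul_assoc,
      ← ENNReal.ofReal_mul (by positivity), ← setLIntegral_const]
    refine lintegral_mono fun x => ?_
    have h := ENNReal.ofReal_le_ofReal (sum_expInt_low hn hc (hA R hR) hφ ho J x)
    rw [ENNReal.ofReal_sum_of_nonneg (fun _ _ => by positivity), ← mul_assoc] at h
    simpa [ENNReal.ofReal_pow] using h
  calc _ ≤ ∑ j ∈ J, (2 * (∫⁻ x in E, ‖low j x‖ₑ ^ 2) +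
          2 * ENNReal.ofReal (D * R ^ (-(2 * s)))) := Finset.sum_le_sum fun j _ => hsingle j
    _ = 2 * (∑ j ∈ J, ∫⁻ x in E, ‖low j x‖ₑ ^ 2) +
          J.card * (2 * ENNReal.ofReal (D * R ^ (-(2 * s)))) := by
      rw [Finset.sum_add_distrib, Finset.mul_sum, Finset.sum_const, nsmul_eq_mul]
    _ ≤ 2 * (ENNReal.ofReal (c⁻¹ * A) * (ENNReal.ofReal (R ^ (n - 2 * s)) * volume E)) +
          J.card * (2 * ENNReal.ofReal (D * R ^ (-(2 * s)))) := by gcongr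
    _ = ENNReal.ofReal (2 * (c⁻¹ * A)) * (ENNReal.ofReal (R ^ (n - 2 * s)) * volume E) +
          ENNReal.ofReal (2 * D) * (J.card * ENNReal.ofReal (R ^ (-(2 * s)))) := by
      rw [ENNReal.ofReal_mul (p := 2) (by positivity), ENNReal.ofReal_mul (p := 2) (by positivity),
        ENNReal.ofReal_mul hD0.le, ENNReal.ofReal_ofNat]
      ring
    _ ≤ _ := by
      rw [mul_add]
      gcongr
      · linarith
      · have : 0 ≤ c⁻¹ * A := by positivity
        linarith

theorem exists_sum_lintegral_expInt_le_card {n : ℕ} (hn : 1 ≤ n) {s θ c : ℝ} (h0 : 0 < θ)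
    (h1 : θ < 1) (hs : 2 * s = n - n * θ) (hc : 0 < c) :
    ∃ B : ℝ, 0 < B ∧ ∀ (G : ℕ → Rn n → ℂ), (∀ j, AEStronglyMeasurable (G j)) →
      (∀ j k, c • ∫ ξ : Rn n, ((‖ξ‖ ^ (2 * s) : ℝ) : ℂ) * (G j ξ * starRingEnd ℂ (G k ξ)) =
        if j = k then 1 else 0) →
      ∀ (E : Set (Rn n)), volume E ≠ 0 → volume E ≠ ∞ → ∀ J : Finset ℕ,
        ∑ j ∈ J, ∫⁻ x in E, ‖expInt (G j) x‖ₑ ^ 2 ≤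
          ENNReal.ofReal B * volume E ^ (1 - θ) * (J.card : ℝ≥0∞) ^ θ := by
  have hn0 : (0 : ℝ) < n := by exact_mod_cast hn
  obtain ⟨B, hB, h⟩ := exists_sum_lintegral_expInt_le hn (s := s) (c := c)
    (by nlinarith) (by nlinarith) hc
  refine ⟨2 * B, by positivity, fun G hG horth E hE0 hE J => ?_⟩
  rcases J.eq_empty_or_nonempty with rfl | hJ
  · simp
  obtain ⟨m, hm⟩ : ∃ m, m = (volume E).toReal := ⟨_, rfl⟩
  have hm0 : 0 < m := hm ▸ ENNReal.toReal_pos hE0 hE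
  have hEm : volume E = ENNReal.ofReal m := by rw [hm, ENNReal.ofReal_toReal hE]
  obtain ⟨N, hN⟩ : ∃ N : ℝ, N = J.card := ⟨_, rfl⟩
  have hN0 : 0 < N := by simpa [hN] using hJ.card_pos
  have hJN : (J.card : ℝ≥0∞) = ENNReal.ofReal N := by simp [hN]
  have e1 : (((N / m) ^ (1 / (n : ℝ))) ^ (n - 2 * s)) * m = N ^ θ * m ^ (1 - θ) := by
    rw [← Real.rpow_mul (by positivity), hs,
      show 1 / (n : ℝ) * (n - (n - n * θ)) = θ by field_simp; ring,
      Real.div_rpow hN0.le hm0.le, Real.rpow_sub hm0, Real.rpow_one]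
    ring
  have e2 : N * ((N / m) ^ (1 / (n : ℝ))) ^ (-(2 * s)) = N ^ θ * m ^ (1 - θ) := by
    rw [← Real.rpow_mul (by positivity), hs,
      show 1 / (n : ℝ) * (-(n - n * θ)) = -(1 - θ) by field_simp,
      Real.rpow_neg (by positivity), Real.div_rpow hN0.le hm0.le, Real.rpow_sub hN0,
      Real.rpow_one]
    have := Real.rpow_pos_of_pos hN0 θ
    have := Real.rpow_pos_of_pos hm0 (1 - θ)
    field_simp
  have key := h G hG horth E J ((N / m) ^ (1 / (n : ℝ))) (by positivity)
  rw [hJN, hEm, ← ENNReal.ofReal_mul (by positivity), ← ENNReal.ofReal_mul (by positivity), e1, e2,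
    ← ENNReal.ofReal_add (by positivity) (by positivity), ← ENNReal.ofReal_mul hB.le] at key
  refine key.trans_eq ?_
  rw [hJN, hEm, ENNReal.ofReal_rpow_of_pos hm0, ENNReal.ofReal_rpow_of_pos hN0,
    ← ENNReal.ofReal_mul (by positivity), ← ENNReal.ofReal_mul (by positivity)]
  congr 1
  ring

/-- The Fourier side of `e^{itΔ}f`. -/
def schrodingerFT {n : ℕ} (f : Rn n → ℂ) (t : ℝ) (ξ : Rn n) : ℂ :=
  Complex.exp (((-(t * ‖ξ‖ ^ 2) : ℝ) : ℂ) * Complex.I) * FT f ξ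

theorem continuous_schrodingerFT {n : ℕ} (f : Rn n → ℂ) (t : ℝ) :
    Continuous (schrodingerFT f t) := by
  have := continuous_FT f
  unfold schrodingerFT
  fun_prop

theorem schrodinger_eq_expInt {n : ℕ} (f : Rn n → ℂ) (t : ℝ) (x : Rn n) :
    schrodinger f t x = ((2 * π : ℝ) ^ (-(n : ℝ)) : ℝ) • expInt (schrodingerFT f t) x := by
  unfold schrodinger prop expInt schrodingerFT
  congr 2 with ξ
  rw [one_mul, ← mul_assoc, ← Complex.exp_add]
  congr 2
  push_cast
  ring

theorem schrodingerFT_mul_conj {n : ℕ} (f g : Rn n → ℂ) (t : ℝ) (ξ : Rn n) :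
    schrodingerFT f t ξ * starRingEnd ℂ (schrodingerFT g t ξ) =
      FT f ξ * starRingEnd ℂ (FT g ξ) := by
  have h : ∀ z : ℂ, ‖z‖ = 1 → z * starRingEnd ℂ z = 1 := fun z hz => by
    rw [Complex.mul_conj, Complex.normSq_eq_norm_sq, hz]
    simp
  rw [schrodingerFT, schrodingerFT, map_mul, mul_mul_mul_comm,
    h _ (Complex.norm_exp_ofReal_mul_I _), one_mul]

theorem continuous_schrodinger_s13 {n : ℕ} (f : Rn n → ℂ) (t : ℝ) : Continuous (schrodinger f t) := by
  rw [funext (schrodinger_eq_expInt f t)]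
  exact (continuous_expInt _).const_smul ((2 * π : ℝ) ^ (-(n : ℝ)))

theorem exists_sum_lintegral_schrodinger_le {n : ℕ} (hn : 1 ≤ n) {s θ : ℝ} (h0 : 0 < θ)
    (h1 : θ < 1) (hs : 2 * s = n - n * θ) :
    ∃ B : ℝ, 0 < B ∧ ∀ f : ℕ → Rn n → ℂ, OrthonormalHs s f → ∀ (t : ℝ) (E : Set (Rn n)),
      volume E ≠ 0 → volume E ≠ ∞ → ∀ J : Finset ℕ,
        ∑ j ∈ J, ∫⁻ x in E, ‖schrodinger (f j) t x‖ₑ ^ 2 ≤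
          ENNReal.ofReal B * volume E ^ (1 - θ) * (J.card : ℝ≥0∞) ^ θ := by
  set c : ℝ := (2 * π : ℝ) ^ (-(n : ℝ)) with hc
  have hc0 : 0 < c := by positivity
  obtain ⟨B, hB, h⟩ := exists_sum_lintegral_expInt_le_card hn h0 h1 hs hc0
  refine ⟨c ^ 2 * B, by positivity, fun f hf t E hE0 hE J => ?_⟩
  have key := h (fun j => schrodingerFT (f j) t)
    (fun j => (continuous_schrodingerFT _ t).aestronglyMeasurable)
    (fun j k => by simpa only [schrodingerFT_mul_conj] using hf j k) E hE0 hE J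
  have e : ∀ j, ∫⁻ x in E, ‖schrodinger (f j) t x‖ₑ ^ 2 =
      ENNReal.ofReal (c ^ 2) * ∫⁻ x in E, ‖expInt (schrodingerFT (f j) t) x‖ₑ ^ 2 := fun j => by
    rw [← lintegral_const_mul' _ _ (by simp)]
    refine lintegral_congr fun x => ?_
    rw [schrodinger_eq_expInt, enorm_smul, mul_pow, ENNReal.ofReal_pow hc0.le,
      Real.enorm_of_nonneg hc0.le]
  simp only [e]
  rw [← Finset.mul_sum, ENNReal.ofReal_mul (by positivity), mul_assoc, mul_assoc, ← mul_assoc _ (_ ^ _)]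
  gcongr

/-- If `f` has integral at most `K μ(E)^{1-θ}` over every set `E` of finite measure, then `f`
belongs to weak `L^{1/θ}`. -/
theorem mul_measure_rpow_le_of_setLIntegral_le {α : Type*} [MeasurableSpace α] {μ : Measure α}
    [SigmaFinite μ] {θ : ℝ} (h0 : 0 < θ) {F : α → ℝ≥0∞} (hF : Measurable F) {K : ℝ≥0∞}
    (hK : ∀ E, MeasurableSet E → μ E ≠ 0 → μ E ≠ ∞ → ∫⁻ x in E, F x ∂μ ≤ K * μ E ^ (1 - θ))
    {a : ℝ≥0∞} (ha : a ≠ ∞) :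
    a * μ {x | a < F x} ^ θ ≤ K := by
  have hfin : ∀ E, MeasurableSet E → E ⊆ {x | a < F x} → μ E ≠ 0 → μ E ≠ ∞ → a * μ E ^ θ ≤ K := by
    intro E hE hES hE0 hEt
    have h : a * μ E ≤ K * μ E ^ (1 - θ) := by
      rw [← setLIntegral_const]
      exact (setLIntegral_mono' hE fun x hx => (hES hx).le).trans (hK E hE hE0 hEt)
    have hp0 : μ E ^ (1 - θ) ≠ 0 := by simp [ENNReal.rpow_eq_zero_iff, hE0, hEt]
    have hpt : μ E ^ (1 - θ) ≠ ∞ := by simp [ENNReal.rpow_eq_top_iff, hE0, hEt]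
    refine (ENNReal.mul_le_mul_iff_left hp0 hpt).1 ?_
    rw [mul_assoc, ← ENNReal.rpow_add _ _ hE0 hEt]
    simpa using h
  rcases eq_or_ne a 0 with rfl | ha0
  · simp
  by_contra! hlt
  have hlt' : (K / a) ^ θ⁻¹ < μ {x | a < F x} := by
    rw [ENNReal.rpow_inv_lt_iff h0]
    exact ENNReal.div_lt_of_lt_mul' hlt
  obtain ⟨E, hE, hES, hEr, hEt⟩ := Measure.exists_subset_measure_lt_top
    (measurableSet_lt measurable_const hF) hlt'
  have h := hfin E hE hES (pos_of_gt hEr).ne' hEt.ne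
  rw [ENNReal.rpow_inv_lt_iff h0, ENNReal.div_lt_iff (Or.inl ha0) (Or.inl ha), mul_comm] at hEr
  exact absurd h (not_le.2 hEr)

/-- (Bez–Hong–Lee–Nakamura–Sawano.)  Boundary case `q = ∞`:
for `1 < p < ∞` and `2s = n - n/p`, the restricted weak-type estimate
`‖Σ λ_j |e^{itΔ}f_j|²‖_{L^∞(ℝ, L^{p,∞}(ℝⁿ))} ≲ ‖λ‖_{ℓ^{p,1}}` holds over systems
orthonormal in `Ḣ^s(ℝⁿ)`. -/
theorem boundary_q_infty (n : ℕ) (hn : 1 ≤ n) (p s : ℝ) (hp : 1 < p)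
    (hs : 2 * s = n - n / p) :
    ∃ C : ℝ, 0 < C ∧ ∀ (f : ℕ → Rn n → ℂ) (lam : ℕ → ℝ),
      OrthonormalHs s f → seqLor (1 / p) 1 lam ≠ ∞ →
      eLp volume ∞ (fun t => wLp (ENNReal.ofReal p) (density lam f t))
        ≤ ENNReal.ofReal C * seqLor (1 / p) 1 lam := by
  have hp0 : 0 < p := by linarith
  have h0 : 0 < 1 / p := by positivity
  have h1 : 1 / p < 1 := by rwa [div_lt_one hp0]
  obtain ⟨B, hB, h⟩ := exists_sum_lintegral_schrodinger_le hn h0 h1 (s := s) (by rw [hs]; ring)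
  refine ⟨B, hB, fun f lam hf _ => ?_⟩
  rw [eLp, if_pos rfl]
  refine essSup_le_of_ae_le _ (ae_of_all _ fun t => ?_)
  simp only [wLp, lor, ENNReal.ofReal_ne_top, if_false, if_true, ENNReal.toReal_ofReal hp0.le]
  refine iSup₂_le fun a _ => ?_
  set D : Rn n → ℝ≥0∞ := fun x =>
    ∑' j, ENNReal.ofReal |lam j| * ‖schrodinger (f j) t x‖ₑ ^ 2 with hD
  have hum : ∀ j, Measurable fun x => ‖schrodinger (f j) t x‖ₑ ^ 2 := fun j =>
    (continuous_schrodinger_s13 (f j) t).measurable.enorm.pow_const 2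
  have hDm : Measurable D := Measurable.tsum fun j => (hum j).const_mul _
  have hdD : ∀ x, ‖density lam f t x‖ₑ ≤ D x := fun x => by
    refine enorm_tsum_le_tsum_enorm.trans_eq (tsum_congr fun j => ?_)
    rw [enorm_mul, enorm_pow, enorm_norm, Real.enorm_eq_ofReal_abs]
  have hK : ∀ E, MeasurableSet E → volume E ≠ 0 → volume E ≠ ∞ →
      ∫⁻ x in E, D x ≤ ENNReal.ofReal B * seqLor (1 / p) 1 lam * volume E ^ (1 - 1 / p) := by
    intro E _ hE0 hE
    rw [hD, lintegral_tsum fun j => ((hum j).const_mul _).aemeasurable, mul_right_comm]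
    simp only [lintegral_const_mul _ (hum _)]
    exact tsum_mul_le_seqLor h0 h1.le lam _ _ (h f hf t E hE0 hE)
  refine le_trans ?_ (mul_measure_rpow_le_of_setLIntegral_le h0 hDm hK
    (ENNReal.ofReal_ne_top (r := a)))
  gcongr
  exact hdD _
end
end
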